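/- arXiv:2604.23708 — 2 statements merged into one kernel-verified Lean document; each statement's English description precedes it below -/
import Mathlib

section
/- For every s with 0 < s < 1, the rescaled integrals in the extensive-coupling regime satisfy lim_{N→∞} Ĩ_{0,N}(s) = √s · (1 − s). -/
open MeasureTheory Real Filter Complex

/-- The exponent `L(R₁,R₂,θ)` of the Laplace integral in the extensive-coupling regime. -/
noncomputable def Lfun (s R₁ R₂ θ : ℝ) : ℝ :=
  R₁ + R₂ - 2 * (1 - s) - Real.log (R₁ * R₂ + 2 * s * Real.sqrt (R₁ * R₂) * Real.cos θ + s ^ 2)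

set_option linter.unusedVariables false in
/-- `W_{0,N}` (independent of `N`). -/
noncomputable def W0 (s : ℝ) (N : ℕ) (R₁ R₂ θ : ℝ) : ℂ :=
  ((s * Real.sqrt (R₁ * R₂) : ℝ) : ℂ) *
      ((R₁ : ℂ) * Complex.exp (-(θ : ℂ) * Complex.I) + (R₂ : ℂ) * Complex.exp ((θ : ℂ) * Complex.I))
    + ((s ^ 2 * (R₁ + R₂) : ℝ) : ℂ)

/-- `W_{1,N}`. -/
noncomputable def W1 (s : ℝ) (N : ℕ) (R₁ R₂ θ : ℝ) : ℂ :=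
  ((s * ((N : ℝ) / ((N : ℝ) - 1)) * (R₁ * R₂) : ℝ) : ℂ)
    + ((s ^ 2 * ((N : ℝ) / ((N : ℝ) - 1)) * Real.sqrt (R₁ * R₂) : ℝ) : ℂ) *
        (Complex.exp ((θ : ℂ) * Complex.I) + Complex.exp (-(θ : ℂ) * Complex.I))
    - ((s ^ 2 * Real.sqrt (R₁ * R₂) : ℝ) : ℂ) * Complex.exp ((θ : ℂ) * Complex.I)
    + ((s ^ 3 / ((N : ℝ) - 1) : ℝ) : ℂ)

/-- `W_{2,N}`: the complex conjugate of `W_{1,N}`. -/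
noncomputable def W2 (s : ℝ) (N : ℕ) (R₁ R₂ θ : ℝ) : ℂ :=
  (starRingEnd ℂ) (W1 s N R₁ R₂ θ)

/-- The three functions `W_{j,N}`, `j = 0, 1, 2`. -/
noncomputable def Wfun (s : ℝ) (N : ℕ) : Fin 3 → ℝ → ℝ → ℝ → ℂ := ![W0 s N, W1 s N, W2 s N]

/-- The rescaled integral `Ĩ_{j,N}(s)` in the extensive-coupling regime. -/
noncomputable def Itilde (s : ℝ) (N : ℕ) (j : Fin 3) : ℂ :=
  (((1 / Real.sqrt 2) * ((N : ℝ) / (2 * Real.pi)) ^ ((3:ℝ) / 2) : ℝ) : ℂ) *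
    ∫ x in (Set.Ioi (0:ℝ)) ×ˢ (Set.Ioi (0:ℝ)) ×ˢ (Set.Icc (0:ℝ) (2 * Real.pi)),
      ((Real.exp (-(N : ℝ) * Lfun s x.1 x.2.1 x.2.2) /
          (x.1 * x.2.1 + 2 * s * Real.sqrt (x.1 * x.2.1) * Real.cos x.2.2 + s ^ 2) ^ 2 : ℝ) : ℂ) *
        Wfun s N j x.1 x.2.1 x.2.2


section ExactEvaluation

lemma integrableOn_sqrt_pow_mul_exp {c : ℝ} (hc : 0 < c) (p : ℕ) :
    IntegrableOn (fun R : ℝ => √R ^ p * Real.exp (-(c * R))) (Set.Ioi 0) := by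
  have h := integrableOn_rpow_mul_exp_neg_mul_rpow (p := 1) (s := (p : ℝ) / 2) (b := c)
    (by have : (0 : ℝ) ≤ (p : ℝ) / 2 := by positivity
        linarith) one_pos hc
  refine h.congr_fun (fun R hR => ?_) measurableSet_Ioi
  have hR' : (0 : ℝ) ≤ R := le_of_lt hR
  simp only [Real.rpow_one, neg_mul]
  rw [Real.sqrt_eq_rpow, ← Real.rpow_natCast, ← Real.rpow_mul hR']
  ring_nf

lemma integral_sqrt_pow_mul_exp {c : ℝ} (hc : 0 < c) (k : ℕ) :
    ∫ R in Set.Ioi (0 : ℝ), √R ^ (2 * k) * Real.exp (-(c * R)) = k.factorial / c ^ (k + 1) := by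
  have h := Real.integral_rpow_mul_exp_neg_mul_Ioi (a := (k : ℝ) + 1) (r := c)
    (by positivity) hc
  rw [Real.Gamma_nat_eq_factorial] at h
  have h2 : (1 / c) ^ ((k : ℝ) + 1) * (k.factorial : ℝ) = k.factorial / c ^ (k + 1) := by
    rw [← Nat.cast_add_one, Real.rpow_natCast, one_div, inv_pow]
    field_simp
  rw [← h2, ← h]
  refine setIntegral_congr_fun measurableSet_Ioi fun R hR => ?_
  have hR' : (0 : ℝ) ≤ R := le_of_lt hR
  simp only [add_sub_cancel_right, Real.rpow_natCast]
  rw [pow_mul, Real.sq_sqrt hR']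

lemma integral_exp_int_mul (k : ℤ) :
    ∫ θ in Set.Icc (0 : ℝ) (2 * π), Complex.exp (k * (θ * Complex.I)) =
      if k = 0 then ((2 * π : ℝ) : ℂ) else 0 := by
  rw [integral_Icc_eq_integral_Ioc, ← intervalIntegral.integral_of_le (by positivity)]
  split_ifs with hk
  · simp [hk]
  · have hc : (k : ℂ) * Complex.I ≠ 0 := by simp [hk]
    have := integral_exp_mul_complex (a := 0) (b := 2 * π) hc
    rw [show (fun θ : ℝ => Complex.exp (k * (θ * Complex.I))) =
      fun θ : ℝ => Complex.exp (k * Complex.I * θ) from by ext; ring_nf, this]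
    have h1 : Complex.exp (k * Complex.I * ((2 * π : ℝ) : ℂ)) = 1 := by
      rw [Complex.exp_eq_one_iff]
      exact ⟨k, by push_cast; ring⟩
    rw [h1]
    simp

/-- A product of a function of `R₁`, a function of `R₂` and a character in `θ`. -/
noncomputable def tensorTerm (c : ℝ) (p q : ℕ) (k : ℤ) (x : ℝ × ℝ × ℝ) : ℂ :=
  ((√x.1 ^ p * Real.exp (-(c * x.1)) : ℝ) : ℂ) *
    (((√x.2.1 ^ q * Real.exp (-(c * x.2.1)) : ℝ) : ℂ) *
      Complex.exp (k * (x.2.2 * Complex.I)))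

/-- The domain of integration. -/
def laplaceDomain : Set (ℝ × ℝ × ℝ) :=
  Set.Ioi (0 : ℝ) ×ˢ Set.Ioi (0 : ℝ) ×ˢ Set.Icc (0 : ℝ) (2 * π)

lemma measurableSet_laplaceDomain : MeasurableSet laplaceDomain :=
  measurableSet_Ioi.prod (measurableSet_Ioi.prod measurableSet_Icc)

lemma integrableOn_tensorTerm {c : ℝ} (hc : 0 < c) (p q : ℕ) (k : ℤ) :
    IntegrableOn (tensorTerm c p q k) laplaceDomain := by
  unfold laplaceDomain IntegrableOn
  rw [Measure.volume_eq_prod, ← Measure.prod_restrict]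
  refine Integrable.mul_prod (f := fun R : ℝ => ((√R ^ p * Real.exp (-(c * R)) : ℝ) : ℂ))
    (g := fun y : ℝ × ℝ => ((√y.1 ^ q * Real.exp (-(c * y.1)) : ℝ) : ℂ) *
      Complex.exp (k * (y.2 * Complex.I)))
    (integrableOn_sqrt_pow_mul_exp hc p).ofReal ?_
  rw [Measure.volume_eq_prod, ← Measure.prod_restrict]
  refine Integrable.mul_prod (f := fun R : ℝ => ((√R ^ q * Real.exp (-(c * R)) : ℝ) : ℂ))
    (g := fun θ : ℝ => Complex.exp (k * (θ * Complex.I)))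
    (integrableOn_sqrt_pow_mul_exp hc q).ofReal ?_
  exact Continuous.integrableOn_Icc (by fun_prop)

lemma integral_tensorTerm (c : ℝ) (p q : ℕ) (k : ℤ) :
    ∫ x in laplaceDomain, tensorTerm c p q k x =
      ((∫ R in Set.Ioi (0 : ℝ), √R ^ p * Real.exp (-(c * R)) : ℝ) : ℂ) *
        (((∫ R in Set.Ioi (0 : ℝ), √R ^ q * Real.exp (-(c * R)) : ℝ) : ℂ) *
          (if k = 0 then ((2 * π : ℝ) : ℂ) else 0)) := by
  rw [← integral_exp_int_mul, ← integral_complex_ofReal, ← integral_complex_ofReal]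
  rw [← setIntegral_prod_mul, ← Measure.volume_eq_prod, ← setIntegral_prod_mul,
    ← Measure.volume_eq_prod]
  rfl

/-- `(√R₁)^(2α) (√R₂)^(2β) e^{-c(R₁+R₂)} e^{-iεθ} (ρ + s e^{iεθ})^(n+1) (ρ + s e^{-iεθ})^n` with
`ρ = √R₁ √R₂`. -/
noncomputable def halfIntegrand (s c : ℝ) (n α β : ℕ) (ε : ℤ) (x : ℝ × ℝ × ℝ) : ℂ :=
  ((√x.1 ^ (2 * α) * √x.2.1 ^ (2 * β) * Real.exp (-(c * x.1)) * Real.exp (-(c * x.2.1)) : ℝ) : ℂ) *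
    (Complex.exp (-(ε * (x.2.2 * Complex.I))) *
      (s * Complex.exp (ε * (x.2.2 * Complex.I)) + ((√x.1 * √x.2.1 : ℝ) : ℂ)) ^ (n + 1) *
      (s * Complex.exp (-(ε * (x.2.2 * Complex.I))) + ((√x.1 * √x.2.1 : ℝ) : ℂ)) ^ n)

lemma halfIntegrand_eq_sum (s c : ℝ) (n α β : ℕ) (ε : ℤ) (x : ℝ × ℝ × ℝ) :
    halfIntegrand s c n α β ε x =
      ∑ a ∈ Finset.range (n + 2), ∑ b ∈ Finset.range (n + 1),
        ((s ^ (a + b) * (n + 1).choose a * n.choose b : ℝ) : ℂ) *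
          tensorTerm c (2 * α + (n + 1 - a) + (n - b)) (2 * β + (n + 1 - a) + (n - b))
            (ε * (a - b - 1)) x := by
  unfold halfIntegrand tensorTerm
  rw [add_pow, add_pow, mul_assoc (Complex.exp _), Finset.sum_mul_sum, Finset.mul_sum, Finset.mul_sum]
  refine Finset.sum_congr rfl fun a _ => ?_
  rw [Finset.mul_sum, Finset.mul_sum]
  refine Finset.sum_congr rfl fun b _ => ?_
  have he : Complex.exp (((ε * (a - b - 1) : ℤ) : ℂ) * (x.2.2 * Complex.I)) =
      Complex.exp (-(ε * (x.2.2 * Complex.I))) *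
      Complex.exp (ε * (x.2.2 * Complex.I)) ^ a * Complex.exp (-(ε * (x.2.2 * Complex.I))) ^ b := by
    rw [← Complex.exp_nat_mul, ← Complex.exp_nat_mul, ← Complex.exp_add, ← Complex.exp_add]
    congr 1
    push_cast
    ring
  rw [he]
  push_cast
  simp only [mul_pow, pow_add]
  ring

lemma integrableOn_halfIntegrand (s : ℝ) {c : ℝ} (hc : 0 < c) (n α β : ℕ) (ε : ℤ) :
    IntegrableOn (halfIntegrand s c n α β ε) laplaceDomain := by
  rw [show halfIntegrand s c n α β ε = _ from funext (halfIntegrand_eq_sum s c n α β ε)]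
  exact integrable_finsetSum _ fun a _ => integrable_finsetSum _ fun b _ =>
    (integrableOn_tensorTerm hc _ _ _).const_mul _

lemma integral_halfIntegrand (s : ℝ) {c : ℝ} (hc : 0 < c) (n α β : ℕ) {ε : ℤ} (hε : ε ≠ 0) :
    ∫ x in laplaceDomain, halfIntegrand s c n α β ε x =
      ((∑ b ∈ Finset.range (n + 1), s ^ (2 * b + 1) * (n + 1).choose (b + 1) * n.choose b *
        ((α + (n - b)).factorial / c ^ (α + (n - b) + 1) *
          ((β + (n - b)).factorial / c ^ (β + (n - b) + 1) * (2 * π))) : ℝ) : ℂ) := by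
  simp_rw [halfIntegrand_eq_sum]
  rw [integral_finsetSum _ fun a _ => integrable_finsetSum _ fun b _ =>
    (integrableOn_tensorTerm hc _ _ _).const_mul _]
  simp_rw [integral_finsetSum _ fun b _ => (integrableOn_tensorTerm hc _ _ _).const_mul _,
    integral_const_mul, integral_tensorTerm]
  rw [Finset.sum_comm, Complex.ofReal_sum]
  refine Finset.sum_congr rfl fun b hb => ?_
  have hb' : b < n + 1 := Finset.mem_range.1 hb
  rw [Finset.sum_eq_single (b + 1)]
  · have h1 : ∀ γ, 2 * γ + (n + 1 - (b + 1)) + (n - b) = 2 * (γ + (n - b)) := by omega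
    rw [h1, h1, integral_sqrt_pow_mul_exp hc, integral_sqrt_pow_mul_exp hc]
    simp only [Nat.cast_add, Nat.cast_one, add_sub_cancel_left, sub_self, mul_zero, if_true]
    push_cast
    ring
  · intro a _ hab
    rw [if_neg]
    · simp
    · simp only [mul_eq_zero, hε, false_or]
      omega
  · intro h
    exact absurd (Finset.mem_range.2 (by omega)) h

lemma normSq_form {s R₁ R₂ : ℝ} (h₁ : 0 ≤ R₁) (h₂ : 0 ≤ R₂) (θ : ℝ) :
    ((R₁ * R₂ + 2 * s * √(R₁ * R₂) * Real.cos θ + s ^ 2 : ℝ) : ℂ) =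
      (s * Complex.exp (θ * Complex.I) + ((√R₁ * √R₂ : ℝ) : ℂ)) *
        (s * Complex.exp (-(θ * Complex.I)) + ((√R₁ * √R₂ : ℝ) : ℂ)) := by
  have he : Complex.exp (θ * Complex.I) * Complex.exp (-(θ * Complex.I)) = 1 := by
    rw [← Complex.exp_add]; simp
  have hc : (Real.cos θ : ℂ) =
      (Complex.exp (θ * Complex.I) + Complex.exp (-(θ * Complex.I))) / 2 := by
    rw [Complex.ofReal_cos, Complex.cos]; ring_nf
  have hR : R₁ * R₂ = (√R₁ * √R₂) ^ 2 := by
    rw [mul_pow, Real.sq_sqrt h₁, Real.sq_sqrt h₂]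
  rw [Real.sqrt_mul h₁, hR]
  push_cast at hc ⊢
  rw [hc]
  linear_combination (-(s : ℂ) ^ 2) * he

lemma form_nonneg {s R₁ R₂ : ℝ} (h₁ : 0 ≤ R₁) (h₂ : 0 ≤ R₂) (θ : ℝ) :
    0 ≤ R₁ * R₂ + 2 * s * √(R₁ * R₂) * Real.cos θ + s ^ 2 := by
  have h : √(R₁ * R₂) ^ 2 = R₁ * R₂ := Real.sq_sqrt (mul_nonneg h₁ h₂)
  have := Real.sin_sq_add_cos_sq θ
  nlinarith [sq_nonneg (√(R₁ * R₂) + s * Real.cos θ), sq_nonneg (s * Real.sin θ)]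

lemma integrand_eq (s : ℝ) (n : ℕ) (hn : n ≠ 0) {x : ℝ × ℝ × ℝ} (hx : x ∈ laplaceDomain) :
    ((Real.exp (-((n + 2 : ℕ) : ℝ) * Lfun s x.1 x.2.1 x.2.2) /
          (x.1 * x.2.1 + 2 * s * √(x.1 * x.2.1) * Real.cos x.2.2 + s ^ 2) ^ 2 : ℝ) : ℂ) *
        Wfun s (n + 2) 0 x.1 x.2.1 x.2.2 =
      ((Real.exp (2 * ((n + 2 : ℕ) : ℝ) * (1 - s)) * s : ℝ) : ℂ) *
        (halfIntegrand s (n + 2 : ℕ) n 1 0 1 x + halfIntegrand s (n + 2 : ℕ) n 0 1 (-1) x) := by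
  obtain ⟨R₁, R₂, θ⟩ := x
  obtain ⟨h₁, h₂, -⟩ := hx
  replace h₁ : 0 ≤ R₁ := le_of_lt h₁
  replace h₂ : 0 ≤ R₂ := le_of_lt h₂
  have hD := normSq_form (s := s) h₁ h₂ θ
  have hD0 := form_nonneg (s := s) h₁ h₂ θ
  have hL : Real.exp (-((n + 2 : ℕ) : ℝ) * Lfun s R₁ R₂ θ) /
      (R₁ * R₂ + 2 * s * √(R₁ * R₂) * Real.cos θ + s ^ 2) ^ 2 =
      Real.exp (2 * ((n + 2 : ℕ) : ℝ) * (1 - s)) * Real.exp (-((n + 2 : ℕ) * R₁)) *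
        Real.exp (-((n + 2 : ℕ) * R₂)) *
        (R₁ * R₂ + 2 * s * √(R₁ * R₂) * Real.cos θ + s ^ 2) ^ n := by
    unfold Lfun
    generalize R₁ * R₂ + 2 * s * √(R₁ * R₂) * Real.cos θ + s ^ 2 = D at hD0
    rcases hD0.eq_or_lt with h | h
    · simp [← h, hn]
    · rw [show -((n + 2 : ℕ) : ℝ) * (R₁ + R₂ - 2 * (1 - s) - Real.log D) =
        2 * ((n + 2 : ℕ) : ℝ) * (1 - s) + -((n + 2 : ℕ) * R₁) + -((n + 2 : ℕ) * R₂) +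
          (n + 2 : ℕ) * Real.log D by ring, Real.exp_add, Real.exp_add, Real.exp_add,
        Real.exp_nat_mul, Real.exp_log h, pow_add]
      field_simp
  have he : Complex.exp (θ * Complex.I) * Complex.exp (-(θ * Complex.I)) = 1 := by
    rw [← Complex.exp_add]; simp
  have q₁ : (R₁ : ℂ) = ((√R₁ : ℝ) : ℂ) ^ 2 := by rw [← Complex.ofReal_pow, Real.sq_sqrt h₁]
  have q₂ : (R₂ : ℂ) = ((√R₂ : ℝ) : ℂ) ^ 2 := by rw [← Complex.ofReal_pow, Real.sq_sqrt h₂]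
  dsimp only
  rw [hL]
  simp only [Wfun, Matrix.cons_val_zero, W0, halfIntegrand]
  rw [Complex.ofReal_mul _ (_ ^ n), Complex.ofReal_pow, hD, Real.sqrt_mul h₁]
  push_cast
  simp only [one_mul, neg_mul, neg_neg, pow_zero, mul_one, mul_pow, pow_succ (_ + _) n]
  rw [q₁, q₂]
  generalize Complex.exp (θ * Complex.I) = e at *
  generalize Complex.exp (-(θ * Complex.I)) = e' at *
  generalize ((√R₁ : ℝ) : ℂ) = r₁
  generalize ((√R₂ : ℝ) : ℂ) = r₂
  generalize (s * e + r₁ * r₂) ^ n = Z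
  generalize (s * e' + r₁ * r₂) ^ n = Z'
  generalize Complex.exp (2 * (n + 2) * (1 - s)) = E
  generalize Complex.exp (-((n + 2) * r₁ ^ 2)) = E₁
  generalize Complex.exp (-((n + 2) * r₂ ^ 2)) = E₂
  linear_combination (-E * E₁ * E₂ * Z * Z' * s ^ 2 * (r₁ ^ 2 + r₂ ^ 2)) * he

lemma integral_Wfun_zero (s : ℝ) (n : ℕ) (hn : n ≠ 0) :
    ∫ x in laplaceDomain,
      ((Real.exp (-((n + 2 : ℕ) : ℝ) * Lfun s x.1 x.2.1 x.2.2) /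
          (x.1 * x.2.1 + 2 * s * √(x.1 * x.2.1) * Real.cos x.2.2 + s ^ 2) ^ 2 : ℝ) : ℂ) *
        Wfun s (n + 2) 0 x.1 x.2.1 x.2.2 =
      ((Real.exp (2 * ((n + 2 : ℕ) : ℝ) * (1 - s)) * s *
        (2 * ∑ b ∈ Finset.range (n + 1), s ^ (2 * b + 1) * (n + 1).choose (b + 1) * n.choose b *
        ((1 + (n - b)).factorial / ((n + 2 : ℕ) : ℝ) ^ (1 + (n - b) + 1) *
          ((n - b).factorial / ((n + 2 : ℕ) : ℝ) ^ (n - b + 1) * (2 * π)))) : ℝ) : ℂ) := by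
  have hc : (0 : ℝ) < (n + 2 : ℕ) := by positivity
  rw [setIntegral_congr_fun measurableSet_laplaceDomain fun x hx => integrand_eq s n hn hx,
    integral_const_mul, integral_add (integrableOn_halfIntegrand s hc n 1 0 1)
      (integrableOn_halfIntegrand s hc n 0 1 (-1)),
    integral_halfIntegrand s hc n 1 0 one_ne_zero,
    integral_halfIntegrand s hc n 0 1 (by norm_num), ← Complex.ofReal_add, ← Complex.ofReal_mul]
  simp only [zero_add]
  rw [two_mul (Finset.sum _ _)]
  congr 3
  exact Finset.sum_congr rfl fun b _ => by ring

end ExactEvaluation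

section BesselAsymptotics

lemma hasSum_of_eq {E : Type*} [AddCommMonoid E] [TopologicalSpace E] {f g : ℕ → E} {a b : E}
    (h : HasSum f a) (hfg : ∀ j, g j = f j) (hab : b = a) : HasSum g b := by
  rwa [funext hfg, hab]

lemma hasSum_integral_exp_mul {l : ℝ} (hl : 0 ≤ l) {u g : ℝ → ℂ} (hu : Continuous u)
    (hg : Continuous g) (hu1 : ∀ θ, ‖u θ‖ ≤ 1) (a b : ℝ) :
    HasSum (fun j : ℕ => ∫ θ in Set.Icc a b, (l * u θ) ^ j / j.factorial * g θ)
      (∫ θ in Set.Icc a b, Complex.exp (l * u θ) * g θ) := by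
  have hint : ∀ j : ℕ, Integrable (fun θ => (l * u θ) ^ j / j.factorial * g θ)
      (volume.restrict (Set.Icc a b)) := fun j =>
    Continuous.integrableOn_Icc (by fun_prop)
  have hsum : Summable fun j : ℕ =>
      ∫ θ in Set.Icc a b, ‖(l * u θ) ^ j / j.factorial * g θ‖ := by
    refine Summable.of_nonneg_of_le (fun j => integral_nonneg fun _ => norm_nonneg _)
      (fun j => ?_) ((Real.summable_pow_div_factorial l).mul_right (∫ θ in Set.Icc a b, ‖g θ‖))
    rw [← integral_const_mul]
    refine integral_mono (hint j).norm
      ((Continuous.integrableOn_Icc (by fun_prop) :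
        IntegrableOn (fun θ => ‖g θ‖) (Set.Icc a b)).const_mul _) fun θ => ?_
    simp only [norm_mul, norm_div, norm_pow, Complex.norm_real, Complex.norm_natCast,
      Real.norm_of_nonneg hl, mul_pow]
    have : ‖u θ‖ ^ j ≤ 1 := pow_le_one₀ (norm_nonneg _) (hu1 θ)
    gcongr
    exact mul_le_of_le_one_right (by positivity) this
  refine hasSum_of_eq (hasSum_integral_of_summable_integral_norm hint hsum) (fun _ => rfl)
    (integral_congr_ae (ae_of_all _ fun θ => ?_))
  simp only
  rw [tsum_mul_right, Complex.exp_eq_exp_ℂ, NormedSpace.exp_eq_tsum_div]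

lemma integral_exp_mul_exp_neg {l : ℝ} (hl : 0 ≤ l) (j : ℕ) :
    ∫ θ in Set.Icc (0 : ℝ) (2 * π), Complex.exp (l * Complex.exp (-(θ * Complex.I))) *
      Complex.exp (j * (θ * Complex.I)) = l ^ j / j.factorial * ((2 * π : ℝ) : ℂ) := by
  have h := hasSum_integral_exp_mul hl (u := fun θ => Complex.exp (-(θ * Complex.I)))
    (g := fun θ => Complex.exp (j * (θ * Complex.I))) (by fun_prop) (by fun_prop)
    (fun θ => by rw [← neg_mul, ← Complex.ofReal_neg, Complex.norm_exp_ofReal_mul_I]) 0 (2 * π)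
  refine h.unique ?_
  have hterm : ∀ k : ℕ, ∫ θ in Set.Icc (0 : ℝ) (2 * π),
      (l * Complex.exp (-(θ * Complex.I))) ^ k / k.factorial * Complex.exp (j * (θ * Complex.I)) =
      l ^ k / k.factorial * if (j - k : ℤ) = 0 then ((2 * π : ℝ) : ℂ) else 0 := fun k => by
    rw [← integral_exp_int_mul, ← integral_const_mul]
    refine integral_congr_ae (ae_of_all _ fun θ => ?_)
    have he : Complex.exp (((j - k : ℤ) : ℂ) * (θ * Complex.I)) =
        Complex.exp (-(θ * Complex.I)) ^ k * Complex.exp (j * (θ * Complex.I)) := by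
      rw [← Complex.exp_nat_mul, ← Complex.exp_add]
      congr 1
      push_cast
      ring
    simp only [he]
    ring
  simp_rw [hterm]
  convert hasSum_single j fun k hk => ?_ using 1
  · simp
  · rw [if_neg (by omega), mul_zero]

/-- Parseval's identity for `θ ↦ exp (l e^{iθ})`. -/
lemma hasSum_sq_pow_div_factorial {l : ℝ} (hl : 0 ≤ l) :
    HasSum (fun j : ℕ => (l ^ j / j.factorial) ^ 2)
      ((2 * π)⁻¹ * ∫ θ in (-π)..π, Real.exp (2 * l * Real.cos θ)) := by
  have h := hasSum_integral_exp_mul hl (u := fun θ => Complex.exp (θ * Complex.I))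
    (g := fun θ => Complex.exp (l * Complex.exp (-(θ * Complex.I)))) (by fun_prop) (by fun_prop)
    (fun θ => by rw [Complex.norm_exp_ofReal_mul_I]) 0 (2 * π)
  have hterm : ∀ j : ℕ, ∫ θ in Set.Icc (0 : ℝ) (2 * π),
      (l * Complex.exp (θ * Complex.I)) ^ j / j.factorial *
        Complex.exp (l * Complex.exp (-(θ * Complex.I))) =
      (((l ^ j / j.factorial) ^ 2 * (2 * π) : ℝ) : ℂ) := fun j => by
    have := congrArg (((l : ℂ) ^ j / j.factorial) * ·) (integral_exp_mul_exp_neg hl j)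
    rw [← integral_const_mul] at this
    push_cast at this ⊢
    rw [sq, mul_assoc, ← this]
    refine integral_congr_ae (ae_of_all _ fun θ => ?_)
    simp only [mul_pow, Complex.exp_nat_mul]
    ring
  have hval : ∫ θ in Set.Icc (0 : ℝ) (2 * π), Complex.exp (l * Complex.exp (θ * Complex.I)) *
      Complex.exp (l * Complex.exp (-(θ * Complex.I))) =
      ((∫ θ in (-π)..π, Real.exp (2 * l * Real.cos θ) : ℝ) : ℂ) := by
    have hper : Function.Periodic (fun θ => Real.exp (2 * l * Real.cos θ)) (2 * π) := fun θ => by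
      simp only [Real.cos_add_two_pi]
    have := hper.intervalIntegral_add_eq 0 (-π)
    rw [zero_add, show -π + 2 * π = π by ring] at this
    rw [← this, intervalIntegral.integral_of_le (by positivity), ← integral_Icc_eq_integral_Ioc,
      ← integral_complex_ofReal]
    refine integral_congr_ae (ae_of_all _ fun θ => ?_)
    simp only
    rw [← Complex.exp_add]
    push_cast
    congr 1
    rw [Complex.cos]
    ring_nf
  simp_rw [hterm] at h
  rw [hval, Complex.hasSum_ofReal] at h
  refine hasSum_of_eq (h.mul_left (2 * π)⁻¹) (fun j => ?_) rfl
  field_simp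

lemma one_sub_cos_eq (x : ℝ) : 1 - Real.cos x = x ^ 2 / 2 * Real.sinc (x / 2) ^ 2 := by
  have h1 : Real.cos x = 1 - 2 * Real.sin (x / 2) ^ 2 := by
    have := Real.cos_sq' (x / 2)
    have h2 := Real.cos_two_mul (x / 2)
    rw [show 2 * (x / 2) = x by ring] at h2
    linarith
  rw [h1]
  rcases eq_or_ne x 0 with rfl | hx
  · simp
  · rw [Real.sinc_of_ne_zero (by simpa using hx)]
    field_simp
    ring

lemma tendsto_sqrt_mul_integral_exp_cos :
    Tendsto (fun l : ℝ => √l * ∫ θ in (-π)..π, Real.exp (-(2 * l * (1 - Real.cos θ)))) atTop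
      (nhds √π) := by
  have hrescale : ∀ l : ℝ, 0 < l →
      √l * ∫ θ in (-π)..π, Real.exp (-(2 * l * (1 - Real.cos θ))) =
        ∫ t, (Set.Ioc (√l * -π) (√l * π)).indicator
          (fun t => Real.exp (-(2 * l * (1 - Real.cos (t / √l))))) t := fun l hl => by
    have hl' : 0 < √l := Real.sqrt_pos.2 hl
    have := intervalIntegral.mul_integral_comp_mul_left (a := -π) (b := π) (c := √l)
      (f := fun t => Real.exp (-(2 * l * (1 - Real.cos (t / √l)))))
    simp only [mul_div_cancel_left₀ _ hl'.ne'] at this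
    rw [this, intervalIntegral.integral_of_le (by nlinarith [Real.pi_pos]),
      integral_indicator measurableSet_Ioc]
  rw [show √π = ∫ t : ℝ, Real.exp (-1 * t ^ 2) by rw [integral_gaussian, div_one]]
  refine Tendsto.congr' ((eventually_gt_atTop 0).mono fun l hl => (hrescale l hl).symm) ?_
  refine tendsto_integral_filter_of_dominated_convergence
    (fun t => Real.exp (-(4 / π ^ 2) * t ^ 2)) ?_ ?_ (integrable_exp_neg_mul_sq (by positivity)) ?_
  · refine Eventually.of_forall fun l => ?_
    exact (Continuous.aestronglyMeasurable (by fun_prop)).indicator measurableSet_Ioc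
  · filter_upwards [eventually_gt_atTop 0] with l hl
    refine ae_of_all _ fun t => ?_
    have hl' : 0 < √l := Real.sqrt_pos.2 hl
    by_cases ht : t ∈ Set.Ioc (√l * -π) (√l * π)
    · rw [Set.indicator_of_mem ht, Real.norm_of_nonneg (Real.exp_nonneg _), Real.exp_le_exp]
      have habs : |t / √l| ≤ π := by
        rw [abs_div, abs_of_pos hl', div_le_iff₀ hl', abs_le]
        constructor <;> nlinarith [ht.1, ht.2]
      have hcos := Real.cos_le_one_sub_mul_cos_sq habs
      rw [div_pow, Real.sq_sqrt hl.le] at hcos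
      have : 2 * l * (2 / π ^ 2 * (t ^ 2 / l)) ≤ 2 * l * (1 - Real.cos (t / √l)) := by
        gcongr
        linarith
      have h2 : 2 * l * (2 / π ^ 2 * (t ^ 2 / l)) = 4 / π ^ 2 * t ^ 2 := by
        field_simp
        ring
      linarith
    · rw [Set.indicator_of_notMem ht, norm_zero]
      positivity
  · refine ae_of_all _ fun t => ?_
    have hsinc : Tendsto (fun l : ℝ => Real.exp (-(t ^ 2 * Real.sinc (t / √l / 2) ^ 2))) atTop
        (nhds (Real.exp (-1 * t ^ 2))) := by
      have h0 : Tendsto (fun l : ℝ => t / √l / 2) atTop (nhds 0) := by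
        simpa using (tendsto_const_nhds.div_atTop Real.tendsto_sqrt_atTop).div_const (2 : ℝ)
      have h1 := (Real.continuous_sinc.tendsto 0).comp h0
      rw [Real.sinc_zero] at h1
      have h2 := ((h1.pow 2).const_mul (t ^ 2)).neg
      simp only [one_pow, mul_one] at h2
      rw [neg_one_mul]
      exact (Real.continuous_exp.tendsto _).comp h2
    refine hsinc.congr' ?_
    filter_upwards [eventually_gt_atTop 0,
      Real.tendsto_sqrt_atTop.eventually_gt_atTop (|t| / π)] with l hl hlt
    have hl' : 0 < √l := Real.sqrt_pos.2 hl
    rw [div_lt_iff₀ Real.pi_pos] at hlt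
    obtain ⟨hlt1, hlt2⟩ := abs_lt.1 hlt
    have ht : t ∈ Set.Ioc (√l * -π) (√l * π) := ⟨by linarith, hlt2.le⟩
    rw [Set.indicator_of_mem ht, one_sub_cos_eq, div_pow, Real.sq_sqrt hl.le]
    congr 2
    field_simp

/-- The Poisson weights `e^{-l} l^j / j!`. -/
noncomputable def poissonWeight (l : ℝ) (j : ℕ) : ℝ :=
  Real.exp (-l) * l ^ j / j.factorial

lemma poissonWeight_nonneg {l : ℝ} (hl : 0 ≤ l) (j : ℕ) : 0 ≤ poissonWeight l j := by
  unfold poissonWeight; positivity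

lemma hasSum_poissonWeight {l : ℝ} (hl : 0 ≤ l) : HasSum (poissonWeight l) 1 :=
  ProbabilityTheory.hasSum_one_poissonMeasure ⟨l, hl⟩

lemma poissonWeight_le_one {l : ℝ} (hl : 0 ≤ l) (j : ℕ) : poissonWeight l j ≤ 1 :=
  le_hasSum (hasSum_poissonWeight hl) j fun i _ => poissonWeight_nonneg hl i

lemma succ_mul_poissonWeight_succ (l : ℝ) (j : ℕ) :
    ((j + 1 : ℕ) : ℝ) * poissonWeight l (j + 1) = l * poissonWeight l j := by
  unfold poissonWeight
  rw [Nat.factorial_succ]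
  push_cast
  field_simp
  ring

lemma hasSum_mul_poissonWeight {l : ℝ} (hl : 0 ≤ l) :
    HasSum (fun j : ℕ => (j : ℝ) * poissonWeight l j) l := by
  rw [← hasSum_nat_add_iff' 1]
  simp_rw [succ_mul_poissonWeight_succ]
  simpa using (hasSum_poissonWeight hl).mul_left l

lemma hasSum_variance_poissonWeight {l : ℝ} (hl : 0 ≤ l) :
    HasSum (fun j : ℕ => ((j : ℝ) - l) ^ 2 * poissonWeight l j) l := by
  have h2 : HasSum (fun j : ℕ => (j : ℝ) * ((j : ℝ) * poissonWeight l j)) (l * (l + 1)) := by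
    rw [← hasSum_nat_add_iff' 1]
    simp_rw [succ_mul_poissonWeight_succ]
    refine hasSum_of_eq (((hasSum_mul_poissonWeight hl).add (hasSum_poissonWeight hl)).mul_left l)
      (fun j => ?_) ?_
    · push_cast
      ring
    · simp
  refine hasSum_of_eq ((h2.sub ((hasSum_mul_poissonWeight hl).mul_left (2 * l))).add
    ((hasSum_poissonWeight hl).mul_left (l ^ 2))) (fun j => ?_) ?_
  · ring
  · ring

lemma hasSum_sq_poissonWeight {l : ℝ} (hl : 0 ≤ l) :
    HasSum (fun j : ℕ => poissonWeight l j ^ 2)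
      ((2 * π)⁻¹ * ∫ θ in (-π)..π, Real.exp (-(2 * l * (1 - Real.cos θ)))) := by
  refine hasSum_of_eq ((hasSum_sq_pow_div_factorial hl).mul_left (Real.exp (-l) ^ 2))
    (fun j => ?_) ?_
  · unfold poissonWeight
    ring
  · rw [mul_left_comm, ← intervalIntegral.integral_const_mul (Real.exp (-l) ^ 2)]
    congr 1
    refine intervalIntegral.integral_congr fun θ _ => ?_
    rw [← Real.exp_nat_mul, ← Real.exp_add]
    congr 1
    push_cast
    ring

lemma tendsto_sqrt_mul_tsum_sq_poissonWeight :
    Tendsto (fun l : ℝ => √l * ∑' j, poissonWeight l j ^ 2) atTop (nhds (1 / (2 * √π))) := by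
  have h := tendsto_sqrt_mul_integral_exp_cos.const_mul (2 * π)⁻¹
  have hval : (2 * π)⁻¹ * √π = 1 / (2 * √π) := by
    have := Real.sq_sqrt Real.pi_pos.le
    have h0 : √π ≠ 0 := by positivity
    field_simp
    linarith
  rw [hval] at h
  refine h.congr' ((eventually_ge_atTop 0).mono fun l hl => ?_)
  simp only
  rw [(hasSum_sq_poissonWeight hl).tsum_eq]
  ring

lemma abs_mul_one_sub_sub_le {s x : ℝ} (hs₀ : 0 ≤ s) (hs₁ : s ≤ 1) (hx₀ : 0 ≤ x) (hx₁ : x ≤ 1) :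
    |x * (1 - x) - s * (1 - s)| ≤ |x - s| := by
  rw [show x * (1 - x) - s * (1 - s) = (x - s) * (1 - x - s) by ring, abs_mul]
  exact mul_le_of_le_one_right (abs_nonneg _) (abs_le.2 ⟨by linarith, by linarith⟩)

lemma abs_sum_sq_poissonWeight_sub_le {s : ℝ} (hs₀ : 0 ≤ s) (hs₁ : s ≤ 1) {N : ℕ} (hN : 0 < N)
    {ε : ℝ} (hε : 0 < ε) :
    |∑ j ∈ Finset.range N, poissonWeight (N * s) j ^ 2 * ((j / N : ℝ) * (1 - j / N)) -
        s * (1 - s) * ∑' j, poissonWeight (N * s) j ^ 2| ≤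
      ε * (∑' j, poissonWeight (N * s) j ^ 2) + s / (ε * N) := by
  have hN' : (0 : ℝ) < N := Nat.cast_pos.2 hN
  have hl : (0 : ℝ) ≤ N * s := by positivity
  set p := poissonWeight (N * s) with hp
  have hS : HasSum (fun j => p j ^ 2) (∑' j, p j ^ 2) :=
    (hasSum_sq_poissonWeight hl).summable.hasSum
  set f : ℕ → ℝ := fun j => if j < N then (j / N : ℝ) * (1 - j / N) else 0 with hf
  have hT : HasSum (fun j => p j ^ 2 * f j)
      (∑ j ∈ Finset.range N, p j ^ 2 * ((j / N : ℝ) * (1 - j / N))) := by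
    refine hasSum_of_eq (hasSum_sum_of_ne_finset_zero (s := Finset.range N) fun j hj => ?_)
      (fun _ => rfl) (Finset.sum_congr rfl fun j hj => ?_)
    · simp [hf, Finset.mem_range.not.1 hj]
    · simp [hf, Finset.mem_range.1 hj]
  have hdiff := hT.sub (hS.mul_left (s * (1 - s)))
  have hbound := (hS.mul_left ε).add
    ((hasSum_variance_poissonWeight hl).mul_left (1 / (ε * N ^ 2)))
  have hval : 1 / (ε * (N : ℝ) ^ 2) * (N * s) = s / (ε * N) := by
    field_simp
  rw [hval] at hbound
  rw [← hdiff.tsum_eq, ← hbound.tsum_eq, ← Real.norm_eq_abs]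
  refine tsum_of_norm_bounded hbound.summable.hasSum fun j => ?_
  have hfj : |f j - s * (1 - s)| ≤ |(j / N : ℝ) - s| := by
    simp only [hf]
    split_ifs with h
    · refine abs_mul_one_sub_sub_le hs₀ hs₁ (by positivity) ?_
      rw [div_le_one hN']
      exact_mod_cast h.le
    · have h1 : 1 ≤ (j / N : ℝ) := by
        rw [one_le_div hN']
        exact_mod_cast not_lt.1 h
      rw [zero_sub, abs_neg, abs_of_nonneg (by nlinarith), abs_of_nonneg (by linarith)]
      nlinarith
  have hamgm : |(j / N : ℝ) - s| ≤ ε + ((j / N : ℝ) - s) ^ 2 / ε := by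
    rw [← sub_nonneg, ← sq_abs]
    generalize |(j / N : ℝ) - s| = y
    have : ε + y ^ 2 / ε - y = ((ε - y / 2) ^ 2 + 3 / 4 * y ^ 2) / ε := by
      field_simp
      ring
    rw [this]
    positivity
  have hp0 : 0 ≤ p j := poissonWeight_nonneg hl j
  have hp1 : p j ≤ 1 := poissonWeight_le_one hl j
  rw [Real.norm_eq_abs, show p j ^ 2 * f j - s * (1 - s) * p j ^ 2 =
    p j ^ 2 * (f j - s * (1 - s)) by ring, abs_mul, abs_of_nonneg (sq_nonneg (p j))]
  calc p j ^ 2 * |f j - s * (1 - s)| ≤ p j ^ 2 * (ε + ((j / N : ℝ) - s) ^ 2 / ε) := by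
        gcongr
        exact hfj.trans hamgm
    _ = ε * p j ^ 2 + ((j / N : ℝ) - s) ^ 2 / ε * p j ^ 2 := by ring
    _ ≤ ε * p j ^ 2 + ((j / N : ℝ) - s) ^ 2 / ε * p j := by
        gcongr
        nlinarith
    _ = ε * p j ^ 2 + 1 / (ε * N ^ 2) * (((j : ℝ) - N * s) ^ 2 * p j) := by
        field_simp

lemma tendsto_sqrt_mul_sum_sq_poissonWeight {s : ℝ} (hs₀ : 0 < s) (hs₁ : s ≤ 1) :
    Tendsto (fun N : ℕ => √(N * s) *
        ∑ j ∈ Finset.range N, poissonWeight (N * s) j ^ 2 * ((j / N : ℝ) * (1 - j / N))) atTop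
      (nhds (s * (1 - s) * (1 / (2 * √π)))) := by
  have hl : Tendsto (fun N : ℕ => (N : ℝ) * s) atTop atTop :=
    tendsto_natCast_atTop_atTop.atTop_mul_const hs₀
  have hS := tendsto_sqrt_mul_tsum_sq_poissonWeight.comp hl
  have hq : Tendsto (fun N : ℕ => √(√(N : ℝ))) atTop atTop :=
    Real.tendsto_sqrt_atTop.comp (Real.tendsto_sqrt_atTop.comp tendsto_natCast_atTop_atTop)
  have hq' := tendsto_inv_atTop_zero.comp hq
  have hbound := hq'.mul (hS.add_const (s * √s))
  rw [zero_mul] at hbound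
  refine tendsto_of_tendsto_of_dist (hS.const_mul (s * (1 - s))) ?_
  refine squeeze_zero' (Eventually.of_forall fun _ => dist_nonneg) ?_ hbound
  filter_upwards [eventually_gt_atTop 0] with N hN
  have hN' : (0 : ℝ) < N := Nat.cast_pos.2 hN
  have hq0 : 0 < √(√(N : ℝ)) := Real.sqrt_pos.2 (Real.sqrt_pos.2 hN')
  have h := abs_sum_sq_poissonWeight_sub_le hs₀.le hs₁ hN (inv_pos.2 hq0)
  simp only [Function.comp_apply]
  rw [dist_comm, Real.dist_eq, mul_left_comm, ← mul_sub, abs_mul,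
    abs_of_nonneg (Real.sqrt_nonneg _)]
  refine (mul_le_mul_of_nonneg_left h (Real.sqrt_nonneg _)).trans_eq ?_
  have e1 : √(N : ℝ) = √(√(N : ℝ)) ^ 2 := (Real.sq_sqrt (Real.sqrt_nonneg _)).symm
  have e2 : (N : ℝ) = √(√(N : ℝ)) ^ 4 := by
    rw [show √(√(N : ℝ)) ^ 4 = (√(√(N : ℝ)) ^ 2) ^ 2 by ring, ← e1, Real.sq_sqrt hN'.le]
  have e3 : √((N : ℝ) * s) * (s / ((√(√(N : ℝ)))⁻¹ * N)) = (√(√(N : ℝ)))⁻¹ * (s * √s) := by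
    rw [Real.sqrt_mul hN'.le]
    generalize √(√(N : ℝ)) = q at *
    rw [e1, e2]
    field_simp
  rw [mul_add, e3]
  ring

end BesselAsymptotics

lemma sum_factorial_eq_sum_poissonWeight {s : ℝ} (hs₀ : 0 < s) (n : ℕ) :
    ∑ b ∈ Finset.range (n + 1), s ^ (2 * b + 1) * (n + 1).choose (b + 1) * n.choose b *
        ((1 + (n - b)).factorial / ((n + 2 : ℕ) : ℝ) ^ (1 + (n - b) + 1) *
          ((n - b).factorial / ((n + 2 : ℕ) : ℝ) ^ (n - b + 1) * (2 * π))) =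
      (n + 1).factorial * n.factorial * (2 * π) * Real.exp (2 * ((n + 2 : ℕ) : ℝ) * s) /
        (s * ((n + 2 : ℕ) : ℝ) ^ (2 * n + 3)) *
      ∑ j ∈ Finset.range (n + 2), poissonWeight ((n + 2 : ℕ) * s) j ^ 2 *
        ((j / (n + 2 : ℕ) : ℝ) * (1 - j / (n + 2 : ℕ))) := by
  rw [Finset.sum_range_succ' _ (n + 1)]
  simp only [Nat.cast_zero, zero_div, zero_mul, mul_zero, add_zero]
  rw [Finset.mul_sum]
  refine Finset.sum_congr rfl fun b hb => ?_
  obtain ⟨d, rfl⟩ := Nat.exists_eq_add_of_le (Nat.lt_succ_iff.1 (Finset.mem_range.1 hb))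
  have c1 : ((b + d + 1).choose (b + 1) : ℝ) =
      (b + d + 1).factorial / ((b + 1).factorial * d.factorial) := by
    rw [Nat.cast_choose ℝ (by omega), show b + d + 1 - (b + 1) = d by omega]
  have c2 : ((b + d).choose b : ℝ) = (b + d).factorial / (b.factorial * d.factorial) := by
    rw [Nat.cast_choose ℝ (by omega), show b + d - b = d by omega]
  have hN : (((b + d + 2 : ℕ) : ℝ)) - ((b + 1 : ℕ) : ℝ) = d + 1 := by push_cast; ring
  have hN0 : ((b + d + 2 : ℕ) : ℝ) ≠ 0 := by positivity
  have hfrac : 1 - ((b + 1 : ℕ) : ℝ) / ((b + d + 2 : ℕ) : ℝ) = (d + 1) / ((b + d + 2 : ℕ) : ℝ) := by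
    rw [← hN]
    field_simp
  have hexp : Real.exp (2 * ((b + d + 2 : ℕ) : ℝ) * s) *
      Real.exp (-(((b + d + 2 : ℕ) : ℝ) * s)) ^ 2 = 1 := by
    rw [← Real.exp_nat_mul, ← Real.exp_add, Real.exp_eq_one_iff]
    push_cast
    ring
  rw [c1, c2, hfrac, Nat.add_sub_cancel_left, add_comm 1 d, Nat.factorial_succ d,
    Nat.factorial_succ b]
  unfold poissonWeight
  rw [Nat.factorial_succ b]
  generalize Real.exp (2 * ((b + d + 2 : ℕ) : ℝ) * s) = E at *
  generalize Real.exp (-(((b + d + 2 : ℕ) : ℝ) * s)) = E' at *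
  generalize ((b + d + 2 : ℕ) : ℝ) = M at *
  have hd : (d.factorial : ℝ) ≠ 0 := by positivity
  have hb' : (b.factorial : ℝ) ≠ 0 := by positivity
  push_cast
  calc _ = (s ^ (2 * b + 1) * (b + d + 1).factorial * (b + d).factorial * (d + 1) * (2 * π)) /
        ((b + 1) * b.factorial ^ 2 * M ^ (2 * d + 3)) * 1 := by
        field_simp
        ring
    _ = _ := by
        rw [← hexp]
        field_simp
        ring

lemma Itilde_zero_eq {s : ℝ} (hs₀ : 0 < s) (n : ℕ) (hn : n ≠ 0) :
    Itilde s (n + 2) 0 =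
      ((2 / √π / √s * (((n + 2 : ℕ) : ℝ) / (((n + 2 : ℕ) : ℝ) - 1)) *
        Stirling.stirlingSeq (n + 2) ^ 2 * (√((n + 2 : ℕ) * s) *
        ∑ j ∈ Finset.range (n + 2), poissonWeight ((n + 2 : ℕ) * s) j ^ 2 *
        ((j / (n + 2 : ℕ) : ℝ) * (1 - j / (n + 2 : ℕ)))) : ℝ) : ℂ) := by
  have hI := integral_Wfun_zero s n hn
  unfold laplaceDomain at hI
  unfold Itilde
  rw [hI, ← Complex.ofReal_mul, sum_factorial_eq_sum_poissonWeight hs₀]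
  congr 1
  generalize ∑ j ∈ Finset.range (n + 2), poissonWeight ((n + 2 : ℕ) * s) j ^ 2 *
        ((j / (n + 2 : ℕ) : ℝ) * (1 - j / (n + 2 : ℕ))) = T
  have hM : (0 : ℝ) < ((n + 2 : ℕ) : ℝ) := by positivity
  have hM1 : (((n + 2 : ℕ) : ℝ)) - 1 = n + 1 := by push_cast; ring
  have hfact : Stirling.stirlingSeq (n + 2) ^ 2 =
      (((n + 2 : ℕ) : ℝ) * (n + 1) * ((n + 1).factorial * n.factorial)) *
        Real.exp (2 * ((n + 2 : ℕ) : ℝ)) / (2 * ((n + 2 : ℕ) : ℝ) ^ (2 * n + 4)) *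
        ((n + 2 : ℕ) / (n + 2 : ℕ)) := by
    have f1 : ((n + 2).factorial : ℝ) = ((n + 2 : ℕ) : ℝ) * (n + 1).factorial := by
      rw [Nat.factorial_succ]; push_cast; ring
    have f2 : ((n + 1).factorial : ℝ) = (n + 1) * n.factorial := by
      rw [Nat.factorial_succ]; push_cast; ring
    rw [Stirling.stirlingSeq, f1, div_pow, mul_pow √_, Real.sq_sqrt (by positivity), div_pow,
      ← Real.exp_nat_mul, mul_one, show 2 * ((n + 2 : ℕ) : ℝ) = (n + 2 : ℕ) + (n + 2 : ℕ) by ring,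
      Real.exp_add, f2]
    field_simp
    ring
  have hpow : (((n + 2 : ℕ) : ℝ) / (2 * π)) ^ ((3 : ℝ) / 2) =
      ((n + 2 : ℕ) / (2 * π)) * (√((n + 2 : ℕ) : ℝ) / (√2 * √π)) := by
    rw [show (3 : ℝ) / 2 = 1 + 1 / 2 by norm_num, Real.rpow_add (by positivity), Real.rpow_one,
      ← Real.sqrt_eq_rpow, Real.sqrt_div hM.le, Real.sqrt_mul (by norm_num)]
  have hexp : Real.exp (2 * ((n + 2 : ℕ) : ℝ)) = Real.exp (2 * ((n + 2 : ℕ) : ℝ) * (1 - s)) *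
      Real.exp (2 * ((n + 2 : ℕ) : ℝ) * s) := by
    rw [← Real.exp_add]
    ring_nf
  have h2 : √2 ^ 2 = 2 := Real.sq_sqrt (by norm_num)
  rw [hfact, hpow, hexp, hM1, Real.sqrt_mul hM.le]
  generalize ((n + 2 : ℕ) : ℝ) = M at *
  field_simp
  rw [h2]
  ring

/-- For `0 < s < 1`, `Ĩ_{0,N}(s) → √s (1 − s)` as `N → ∞`. -/
theorem Itilde0_tendsto (s : ℝ) (hs₀ : 0 < s) (hs₁ : s < 1) :
    Tendsto (fun N : ℕ => Itilde s N 0) atTop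
      (nhds (((Real.sqrt s * (1 - s) : ℝ)) : ℂ)) := by
  have hfrac : Tendsto (fun N : ℕ => (N : ℝ) / ((N : ℝ) - 1)) atTop (nhds 1) := by
    simpa [sub_eq_add_neg] using tendsto_natCast_div_add_atTop (-1 : ℝ)
  have h := ((hfrac.const_mul (2 / √π / √s)).mul (Stirling.tendsto_stirlingSeq_sqrt_pi.pow 2)).mul
    (tendsto_sqrt_mul_sum_sq_poissonWeight hs₀ hs₁.le)
  have hval : 2 / √π / √s * 1 * √π ^ 2 * (s * (1 - s) * (1 / (2 * √π))) = √s * (1 - s) := by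
    have h1 := Real.sq_sqrt hs₀.le
    have h2 : 0 < √s := Real.sqrt_pos.2 hs₀
    have h3 : √π ≠ 0 := by positivity
    field_simp
    rw [h1]
  rw [hval] at h
  refine ((Complex.continuous_ofReal.tendsto _).comp h).congr' ?_
  filter_upwards [eventually_ge_atTop 3] with N hN
  obtain ⟨n, rfl⟩ := Nat.exists_eq_add_of_le' (show 2 ≤ N by omega)
  exact (Itilde_zero_eq hs₀ n (by omega)).symm
end

section
/- For every s with 0 < s < 1 and for j = 1 and j = 2, the rescaled integrals in the extensive-coupling regime satisfy lim_{N→∞} Ĩ_{1,N}(s) = lim_{N→∞} Ĩ_{2,N}(s) = √s · (1 − s)/2. -/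
open MeasureTheory Real Filter Complex

/-- Orthogonality of the characters of the circle. -/
lemma integral_exp_pow_mul_exp_neg_pow (j k : ℕ) :
    ∫ t in (0:ℝ)..(2 * Real.pi),
      Complex.exp ((t : ℂ) * Complex.I) ^ j * Complex.exp (-(t : ℂ) * Complex.I) ^ k
      = if j = k then (2 * Real.pi : ℂ) else 0 := by
  have h : ∀ t : ℝ,
      Complex.exp ((t : ℂ) * Complex.I) ^ j * Complex.exp (-(t : ℂ) * Complex.I) ^ k
        = Complex.exp ((((j : ℂ) - k) * Complex.I) * t) := fun t => by
    rw [← Complex.exp_nat_mul, ← Complex.exp_nat_mul, ← Complex.exp_add]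
    ring_nf
  simp_rw [h]
  split_ifs with hjk
  · subst hjk
    simp
  · have hne : ((j : ℂ) - k) * Complex.I ≠ 0 :=
      mul_ne_zero (sub_ne_zero.2 (by exact_mod_cast hjk)) Complex.I_ne_zero
    rw [integral_exp_mul_complex hne]
    have := Complex.exp_int_mul_two_pi_mul_I ((j : ℤ) - k)
    push_cast at this
    rw [show ((j : ℂ) - k) * Complex.I * ((2 * Real.pi : ℝ) : ℂ)
      = ((j : ℂ) - k) * (2 * Real.pi * Complex.I) by push_cast; ring, this]
    simp

lemma integral_trigPoly_mul_conj_trigPoly (f g : ℕ → ℂ) (a b : ℕ) (hba : b ≤ a) :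
    ∫ t in (0:ℝ)..(2 * Real.pi),
      (∑ j ∈ Finset.range a, f j * Complex.exp ((t : ℂ) * Complex.I) ^ j) *
        (∑ k ∈ Finset.range b, g k * Complex.exp (-(t : ℂ) * Complex.I) ^ k)
      = 2 * Real.pi * ∑ k ∈ Finset.range b, f k * g k := by
  simp_rw [Finset.sum_mul_sum]
  have hint : ∀ j k : ℕ, IntervalIntegrable (fun t : ℝ =>
      f j * Complex.exp ((t : ℂ) * Complex.I) ^ j *
        (g k * Complex.exp (-(t : ℂ) * Complex.I) ^ k)) volume 0 (2 * Real.pi) := fun j k =>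
    Continuous.intervalIntegrable (by fun_prop) _ _
  rw [intervalIntegral.integral_finsetSum
    (fun j _ => Continuous.intervalIntegrable (by fun_prop) _ _)]
  have : ∀ j ∈ Finset.range a, ∫ t in (0:ℝ)..(2 * Real.pi), (∑ k ∈ Finset.range b,
      f j * Complex.exp ((t : ℂ) * Complex.I) ^ j *
        (g k * Complex.exp (-(t : ℂ) * Complex.I) ^ k))
      = ∑ k ∈ Finset.range b, if j = k then 2 * Real.pi * (f k * g k) else 0 := fun j _ => by
    rw [intervalIntegral.integral_finsetSum (fun k _ => hint j k)]
    refine Finset.sum_congr rfl fun k _ => ?_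
    simp_rw [mul_mul_mul_comm (f j)]
    rw [intervalIntegral.integral_const_mul, integral_exp_pow_mul_exp_neg_pow]
    split_ifs with h
    · subst h
      ring
    · simp
  rw [Finset.sum_congr rfl this, Finset.sum_comm, Finset.mul_sum]
  refine Finset.sum_congr rfl fun k hk => ?_
  rw [Finset.sum_ite_eq', if_pos]
  exact Finset.mem_range.2 ((Finset.mem_range.1 hk).trans_le hba)

lemma integrableOn_sqrt_pow_mul_exp_neg (c : ℝ) (hc : 0 < c) (p : ℕ) :
    IntegrableOn (fun R : ℝ => ((Real.sqrt R ^ p * Real.exp (-c * R) : ℝ) : ℂ))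
      (Set.Ioi (0:ℝ)) := by
  have h := integrableOn_rpow_mul_exp_neg_mul_rpow (p := 1) (s := (p : ℝ) / 2) (b := c)
    (by have : (0:ℝ) ≤ p := p.cast_nonneg
        linarith) one_pos hc
  refine Integrable.ofReal (h.congr_fun (fun R hR => ?_) measurableSet_Ioi)
  have hR : (0:ℝ) ≤ R := le_of_lt hR
  simp only [Real.rpow_one]
  rw [Real.sqrt_eq_rpow, ← Real.rpow_natCast, ← Real.rpow_mul hR, one_div_mul_eq_div]
  rfl

lemma integral_sqrt_pow_mul_exp_neg (c : ℝ) (hc : 0 < c) (k : ℕ) :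
    ∫ R in Set.Ioi (0:ℝ), ((Real.sqrt R ^ (k + k) * Real.exp (-c * R) : ℝ) : ℂ)
      = ((k.factorial / c ^ (k + 1) : ℝ) : ℂ) := by
  rw [integral_complex_ofReal]
  congr 1
  have h := Real.integral_rpow_mul_exp_neg_mul_Ioi (a := k + 1) (r := c) (by positivity) hc
  rw [Real.Gamma_nat_eq_factorial] at h
  rw [show (k.factorial / c ^ (k + 1) : ℝ) = (1 / c) ^ ((k : ℝ) + 1) * k.factorial by
    rw [show ((k : ℝ) + 1) = ((k + 1 : ℕ) : ℝ) by push_cast; rfl, Real.rpow_natCast]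
    rw [one_div_pow, mul_comm, div_eq_mul_one_div], ← h]
  refine setIntegral_congr_fun measurableSet_Ioi fun R hR => ?_
  have hR : (0:ℝ) ≤ R := le_of_lt hR
  simp only [add_sub_cancel_right, Real.rpow_natCast]
  rw [← two_mul, pow_mul, Real.sq_sqrt hR]
  ring_nf

/-- The domain of integration of `Itilde`. -/
def polarDomain : Set (ℝ × ℝ × ℝ) :=
  Set.Ioi (0:ℝ) ×ˢ Set.Ioi (0:ℝ) ×ˢ Set.Icc (0:ℝ) (2 * Real.pi)

lemma measurableSet_polarDomain : MeasurableSet polarDomain :=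
  measurableSet_Ioi.prod (measurableSet_Ioi.prod measurableSet_Icc)

lemma volume_restrict_polarDomain :
    (volume : Measure (ℝ × ℝ × ℝ)).restrict polarDomain =
      (volume.restrict (Set.Ioi (0:ℝ))).prod ((volume.restrict (Set.Ioi (0:ℝ))).prod
        (volume.restrict (Set.Icc (0:ℝ) (2 * Real.pi)))) := by
  rw [polarDomain, Measure.prod_restrict, Measure.prod_restrict]
  rfl

/-- `√(R₁R₂)^{j+k} e^{-c(R₁+R₂)} e^{i(j-k)θ}`. -/
noncomputable def gammaMonomial (c : ℝ) (j k : ℕ) (x : ℝ × ℝ × ℝ) : ℂ :=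
  ((Real.sqrt x.1 ^ (j + k) * Real.exp (-c * x.1) : ℝ) : ℂ) *
    (((Real.sqrt x.2.1 ^ (j + k) * Real.exp (-c * x.2.1) : ℝ) : ℂ) *
      (Complex.exp ((x.2.2 : ℂ) * Complex.I) ^ j * Complex.exp (-(x.2.2 : ℂ) * Complex.I) ^ k))

lemma integrableOn_gammaMonomial (c : ℝ) (hc : 0 < c) (j k : ℕ) :
    IntegrableOn (gammaMonomial c j k) polarDomain := by
  rw [IntegrableOn, volume_restrict_polarDomain]
  have hR := integrableOn_sqrt_pow_mul_exp_neg c hc (j + k)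
  have hθ : IntegrableOn (fun t : ℝ =>
      Complex.exp ((t : ℂ) * Complex.I) ^ j * Complex.exp (-(t : ℂ) * Complex.I) ^ k)
      (Set.Icc (0:ℝ) (2 * Real.pi)) :=
    Continuous.integrableOn_Icc (by fun_prop)
  exact Integrable.mul_prod hR (Integrable.mul_prod hR hθ)

lemma integral_gammaMonomial (c : ℝ) (hc : 0 < c) (j k : ℕ) :
    ∫ x in polarDomain, gammaMonomial c j k x =
      if j = k then ((2 * Real.pi * (k.factorial / c ^ (k + 1)) ^ 2 : ℝ) : ℂ) else 0 := by
  rw [volume_restrict_polarDomain]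
  unfold gammaMonomial
  rw [integral_prod_mul (fun R : ℝ => ((Real.sqrt R ^ (j + k) * Real.exp (-c * R) : ℝ) : ℂ))
    (fun y : ℝ × ℝ => (((Real.sqrt y.1 ^ (j + k) * Real.exp (-c * y.1) : ℝ) : ℂ) *
      (Complex.exp ((y.2 : ℂ) * Complex.I) ^ j * Complex.exp (-(y.2 : ℂ) * Complex.I) ^ k))),
    integral_prod_mul (fun R : ℝ => ((Real.sqrt R ^ (j + k) * Real.exp (-c * R) : ℝ) : ℂ))
    (fun t : ℝ => Complex.exp ((t : ℂ) * Complex.I) ^ j * Complex.exp (-(t : ℂ) * Complex.I) ^ k),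
    integral_Icc_eq_integral_Ioc, ← intervalIntegral.integral_of_le (by positivity),
    integral_exp_pow_mul_exp_neg_pow]
  split_ifs with h
  · subst h
    rw [integral_sqrt_pow_mul_exp_neg c hc]
    push_cast
    ring
  · simp

/-- The point `√(R₁R₂) e^{iθ}` and, with `-θ` in place of `θ`, its conjugate. -/
noncomputable def polarPoint (R₁ R₂ θ : ℝ) : ℂ :=
  (Real.sqrt (R₁ * R₂) : ℂ) * Complex.exp ((θ : ℂ) * Complex.I)

lemma weighted_product_eq_sum (s c : ℝ) (a b : ℕ) (x : ℝ × ℝ × ℝ) (hx : x ∈ polarDomain) :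
    ((Real.exp (-c * (x.1 + x.2.1)) : ℝ) : ℂ) * ((polarPoint x.1 x.2.1 x.2.2 + s) ^ a *
      (polarPoint x.1 x.2.1 (-x.2.2) + s) ^ b) =
    ∑ j ∈ Finset.range (a + 1), ∑ k ∈ Finset.range (b + 1),
      (((s ^ (a - j) * a.choose j) * (s ^ (b - k) * b.choose k) : ℝ) : ℂ) *
        gammaMonomial c j k x := by
  have h1 : (0:ℝ) < x.1 := hx.1
  rw [add_pow, add_pow, Finset.sum_mul_sum, Finset.mul_sum]
  refine Finset.sum_congr rfl fun j _ => ?_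
  rw [Finset.mul_sum]
  refine Finset.sum_congr rfl fun k _ => ?_
  rw [polarPoint, polarPoint, gammaMonomial, Real.sqrt_mul h1.le, mul_add, Real.exp_add]
  push_cast
  ring

lemma integrableOn_weighted_product (s c : ℝ) (hc : 0 < c) (a b : ℕ) :
    IntegrableOn (fun x : ℝ × ℝ × ℝ => ((Real.exp (-c * (x.1 + x.2.1)) : ℝ) : ℂ) *
      ((polarPoint x.1 x.2.1 x.2.2 + s) ^ a * (polarPoint x.1 x.2.1 (-x.2.2) + s) ^ b))
      polarDomain := by
  refine IntegrableOn.congr_fun ?_ (fun x hx => (weighted_product_eq_sum s c a b x hx).symm) measurableSet_polarDomain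
  exact integrable_finsetSum _ fun j _ => integrable_finsetSum _ fun k _ =>
    (integrableOn_gammaMonomial c hc j k).const_mul _

lemma integral_weighted_product (s c : ℝ) (hc : 0 < c) (a b : ℕ) (hba : b ≤ a) :
    ∫ x in polarDomain, ((Real.exp (-c * (x.1 + x.2.1)) : ℝ) : ℂ) *
      ((polarPoint x.1 x.2.1 x.2.2 + s) ^ a * (polarPoint x.1 x.2.1 (-x.2.2) + s) ^ b)
    = ((2 * Real.pi * ∑ k ∈ Finset.range (b + 1), s ^ (a - k) * a.choose k *
        (s ^ (b - k) * b.choose k) * (k.factorial / c ^ (k + 1)) ^ 2 : ℝ) : ℂ) := by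
  have hint : ∀ j k : ℕ, IntegrableOn (fun x : ℝ × ℝ × ℝ =>
      (((s ^ (a - j) * a.choose j) * (s ^ (b - k) * b.choose k) : ℝ) : ℂ) *
        gammaMonomial c j k x) polarDomain := fun j k =>
    (integrableOn_gammaMonomial c hc j k).const_mul _
  rw [setIntegral_congr_fun measurableSet_polarDomain
    (fun x hx => weighted_product_eq_sum s c a b x hx),
    integral_finsetSum _ fun j _ => integrable_finsetSum _ fun k _ => hint j k]
  simp_rw [integral_finsetSum _ fun k _ => hint _ k, integral_const_mul,
    integral_gammaMonomial c hc]
  rw [Finset.sum_comm]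
  push_cast
  rw [Finset.mul_sum]
  refine Finset.sum_congr rfl fun k hk => ?_
  simp_rw [mul_ite, mul_zero]
  rw [Finset.sum_ite_eq', if_pos (Finset.mem_range.2 (by
    have := Finset.mem_range.1 hk
    omega))]
  ring

lemma ofReal_quadratic_eq (s : ℝ) {R₁ R₂ : ℝ} (h₁ : 0 < R₁) (h₂ : 0 < R₂) (θ : ℝ) :
    ((R₁ * R₂ + 2 * s * Real.sqrt (R₁ * R₂) * Real.cos θ + s ^ 2 : ℝ) : ℂ) =
      (polarPoint R₁ R₂ θ + s) * (polarPoint R₁ R₂ (-θ) + s) := by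
  have hsq : (Real.sqrt (R₁ * R₂) : ℂ) ^ 2 = R₁ * R₂ := by
    rw [← Complex.ofReal_pow, Real.sq_sqrt (by positivity)]
    push_cast
    rfl
  have he : Complex.exp ((θ : ℂ) * Complex.I) * Complex.exp (-(θ : ℂ) * Complex.I) = 1 := by
    rw [← Complex.exp_add]
    simp
  rw [polarPoint, polarPoint]
  push_cast
  rw [Complex.cos, ← hsq]
  linear_combination (-(Real.sqrt (R₁ * R₂) : ℂ) ^ 2) * he

lemma W1_eq (s : ℝ) (N : ℕ) (hN : 2 ≤ N) {R₁ R₂ : ℝ} (h₁ : 0 < R₁) (h₂ : 0 < R₂) (θ : ℝ) :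
    W1 s N R₁ R₂ θ = ((s * (N / (N - 1)) : ℝ) : ℂ) *
        ((polarPoint R₁ R₂ θ + s) * (polarPoint R₁ R₂ (-θ) + s))
      - (s : ℂ) ^ 2 * (polarPoint R₁ R₂ θ + s) := by
  have hsq : (Real.sqrt (R₁ * R₂) : ℂ) ^ 2 = R₁ * R₂ := by
    rw [← Complex.ofReal_pow, Real.sq_sqrt (by positivity)]
    push_cast
    rfl
  have he : Complex.exp ((θ : ℂ) * Complex.I) * Complex.exp (-(θ : ℂ) * Complex.I) = 1 := by
    rw [← Complex.exp_add]
    simp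
  have hN' : (N : ℂ) - 1 ≠ 0 := sub_ne_zero.2 (by exact_mod_cast (by omega : N ≠ 1))
  rw [W1, polarPoint, polarPoint]
  push_cast
  rw [← hsq]
  have hα : (s : ℂ) ^ 3 / ((N : ℂ) - 1) = (s : ℂ) ^ 3 * ((N : ℂ) / (N - 1)) - s ^ 3 := by
    field_simp
    ring
  rw [hα]
  linear_combination (-(s : ℂ) * ((N : ℂ) / (N - 1)) * (Real.sqrt (R₁ * R₂) : ℂ) ^ 2) * he

lemma exp_neg_mul_Lfun_div (s : ℝ) (N : ℕ) (hN : 3 ≤ N) {R₁ R₂ : ℝ} (h₁ : 0 < R₁) (h₂ : 0 < R₂)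
    (θ : ℝ) :
    Real.exp (-(N : ℝ) * Lfun s R₁ R₂ θ) /
        (R₁ * R₂ + 2 * s * Real.sqrt (R₁ * R₂) * Real.cos θ + s ^ 2) ^ 2 =
      Real.exp (2 * N * (1 - s)) * Real.exp (-(N : ℝ) * (R₁ + R₂)) *
        (R₁ * R₂ + 2 * s * Real.sqrt (R₁ * R₂) * Real.cos θ + s ^ 2) ^ (N - 2) := by
  rw [Lfun]
  have hD : 0 ≤ R₁ * R₂ + 2 * s * Real.sqrt (R₁ * R₂) * Real.cos θ + s ^ 2 := by
    have := Real.sq_sqrt (mul_pos h₁ h₂).le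
    nlinarith [sq_nonneg (Real.sqrt (R₁ * R₂) + s * Real.cos θ), Real.sin_sq_add_cos_sq θ,
      sq_nonneg (s * Real.sin θ)]
  generalize R₁ * R₂ + 2 * s * Real.sqrt (R₁ * R₂) * Real.cos θ + s ^ 2 = D at hD
  rcases hD.eq_or_lt with rfl | hD
  · rw [zero_pow (by omega), zero_pow (by omega)]
    simp
  · rw [← Real.exp_add, show -(N : ℝ) * (R₁ + R₂ - 2 * (1 - s) - Real.log D) =
      (2 * N * (1 - s) + -(N : ℝ) * (R₁ + R₂)) + N * Real.log D by ring, Real.exp_add _ (_ * _),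
      mul_comm (N : ℝ) (Real.log D), Real.exp_mul, Real.exp_log hD, Real.rpow_natCast,
      div_eq_iff (by positivity), mul_assoc _ (D ^ (N - 2)),
      ← pow_add, Nat.sub_add_cancel (by omega)]

lemma sum_choose_sq_eq (s c : ℝ) (hc : 0 < c) (M : ℕ) :
    ∑ k ∈ Finset.range (M + 1), s ^ (M - k) * M.choose k * (s ^ (M - k) * M.choose k) *
        (k.factorial / c ^ (k + 1)) ^ 2 =
      (M.factorial / c ^ (M + 1)) ^ 2 *
        ∑ m ∈ Finset.range (M + 1), ((s * c) ^ m / m.factorial) ^ 2 := by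
  rw [← Finset.sum_range_reflect, Finset.mul_sum]
  refine Finset.sum_congr rfl fun m hm => ?_
  obtain ⟨k, rfl⟩ := Nat.exists_eq_add_of_le (Nat.lt_succ_iff.1 (Finset.mem_range.1 hm))
  have h := Nat.add_choose_mul_factorial_mul_factorial m k
  have h' : ((m + k).choose k : ℝ) = (m + k).factorial / (m.factorial * k.factorial) := by
    rw [← h]
    push_cast
    field_simp
  rw [show m + k + 1 - 1 - m = k by omega, show m + k - k = m by omega, h']
  have := hc.ne'
  field_simp
  ring

lemma sum_choose_succ_mul_choose_eq (s c : ℝ) (hc : 0 < c) (M : ℕ) :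
    ∑ k ∈ Finset.range (M + 1), s ^ (M + 1 - k) * (M + 1).choose k * (s ^ (M - k) * M.choose k) *
        (k.factorial / c ^ (k + 1)) ^ 2 =
      ((M + 1).factorial * M.factorial / c ^ (2 * M + 3)) *
        ∑ m ∈ Finset.range (M + 1),
          ((s * c) ^ (m + 1) / (m + 1).factorial) * ((s * c) ^ m / m.factorial) := by
  rw [← Finset.sum_range_reflect, Finset.mul_sum]
  refine Finset.sum_congr rfl fun m hm => ?_
  obtain ⟨k, rfl⟩ := Nat.exists_eq_add_of_le (Nat.lt_succ_iff.1 (Finset.mem_range.1 hm))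
  have h (m : ℕ) : ((m + k).choose k : ℝ) = (m + k).factorial / (m.factorial * k.factorial) := by
    rw [← Nat.add_choose_mul_factorial_mul_factorial m k]
    push_cast
    field_simp
  have h1 := h (m + 1)
  rw [show m + 1 + k = m + k + 1 by ring] at h1
  rw [show m + k + 1 - 1 - m = k by omega, show m + k - k = m by omega,
    show m + k + 1 - k = m + 1 by omega, h m, h1]
  have := hc.ne'
  field_simp
  ring

/-- `∑_{m<N} q_m² - s ∑_{m<N-1} q_{m+1} q_m` with `q_m = (sN)^m / m!`. -/
noncomputable def besselSum (s : ℝ) (N : ℕ) : ℝ :=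
  ∑ m ∈ Finset.range N, ((s * N) ^ m / m.factorial) ^ 2 -
    s * ∑ m ∈ Finset.range (N - 1),
      ((s * N) ^ (m + 1) / (m + 1).factorial) * ((s * N) ^ m / m.factorial)

lemma Itilde_one_eq (s : ℝ) (N : ℕ) (hN : 3 ≤ N) :
    Itilde s N 1 = (((1 / Real.sqrt 2) * ((N : ℝ) / (2 * Real.pi)) ^ ((3:ℝ) / 2) *
      (Real.exp (2 * N * (1 - s)) * (2 * Real.pi * (s * (N / (N - 1)) *
        (((N - 1).factorial / N ^ N) ^ 2 * besselSum s N)))) : ℝ) : ℂ) := by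
  have hN0 : (0:ℝ) < N := by
    have : 0 < N := by omega
    exact_mod_cast this
  have hpt : ∀ x ∈ polarDomain,
      ((Real.exp (-(N : ℝ) * Lfun s x.1 x.2.1 x.2.2) /
          (x.1 * x.2.1 + 2 * s * Real.sqrt (x.1 * x.2.1) * Real.cos x.2.2 + s ^ 2) ^ 2 : ℝ) : ℂ) *
        Wfun s N 1 x.1 x.2.1 x.2.2 =
      ((Real.exp (2 * N * (1 - s)) * (s * (N / (N - 1))) : ℝ) : ℂ) *
        (((Real.exp (-N * (x.1 + x.2.1)) : ℝ) : ℂ) * ((polarPoint x.1 x.2.1 x.2.2 + s) ^ (N - 1) *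
          (polarPoint x.1 x.2.1 (-x.2.2) + s) ^ (N - 1))) -
      ((Real.exp (2 * N * (1 - s)) * s ^ 2 : ℝ) : ℂ) *
        (((Real.exp (-N * (x.1 + x.2.1)) : ℝ) : ℂ) * ((polarPoint x.1 x.2.1 x.2.2 + s) ^ (N - 1) *
          (polarPoint x.1 x.2.1 (-x.2.2) + s) ^ (N - 2))) := by
    rintro x ⟨h1, h2, -⟩
    have h1 : 0 < x.1 := h1
    have h2 : 0 < x.2.1 := h2
    rw [exp_neg_mul_Lfun_div s N hN h1 h2]
    change _ * W1 s N x.1 x.2.1 x.2.2 = _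
    rw [W1_eq s N (by omega) h1 h2, Complex.ofReal_mul _ (_ ^ (N - 2)), Complex.ofReal_pow,
      ofReal_quadratic_eq s h1 h2]
    obtain ⟨n, rfl⟩ : ∃ n, N = n + 2 := ⟨N - 2, by omega⟩
    rw [show n + 2 - 2 = n by omega, show n + 2 - 1 = n + 1 by omega]
    simp only [Complex.ofReal_mul, Complex.ofReal_pow, mul_pow]
    ring
  rw [Itilde, show Set.Ioi (0:ℝ) ×ˢ Set.Ioi (0:ℝ) ×ˢ Set.Icc (0:ℝ) (2 * Real.pi) = polarDomain
    from rfl, setIntegral_congr_fun measurableSet_polarDomain hpt,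
    integral_sub ((integrableOn_weighted_product s N hN0 _ _).const_mul _)
      ((integrableOn_weighted_product s N hN0 _ _).const_mul _),
    integral_const_mul, integral_const_mul, integral_weighted_product s N hN0 _ _ le_rfl,
    integral_weighted_product s N hN0 _ _ (by omega)]
  rw [← Complex.ofReal_mul, ← Complex.ofReal_mul, ← Complex.ofReal_sub, ← Complex.ofReal_mul]
  congr 1
  obtain ⟨n, rfl⟩ : ∃ n, N = n + 2 := ⟨N - 2, by omega⟩
  rw [show n + 2 - 2 = n by omega, show n + 2 - 1 = n + 1 by omega,
    sum_choose_sq_eq s _ hN0, sum_choose_succ_mul_choose_eq s _ hN0, besselSum,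
    show n + 2 - 1 = n + 1 by omega]
  have hn : ((n + 2 : ℕ) : ℝ) - 1 = n + 1 := by
    push_cast
    ring
  rw [hn, show n + 1 + 1 = n + 2 by omega, Nat.factorial_succ n]
  have hn' : (n : ℝ) + 1 ≠ 0 := by positivity
  push_cast at hN0 ⊢
  field_simp
  ring

lemma exp_sub_sum_le (x l : ℝ) (hx : 0 ≤ x) (hl : 1 ≤ l) (M : ℕ) :
    Real.exp x - ∑ m ∈ Finset.range M, x ^ m / m.factorial ≤ Real.exp (l * x) / l ^ M := by
  have hsum (y : ℝ) : HasSum (fun m : ℕ => y ^ m / m.factorial) (Real.exp y) := by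
    rw [Real.exp_eq_exp_ℝ]
    exact NormedSpace.expSeries_div_hasSum_exp y
  have hl0 : 0 < l := by linarith
  have hle : ∑' m : ℕ, x ^ (m + M) / (m + M).factorial ≤
      ∑' m : ℕ, (l * x) ^ (m + M) / (m + M).factorial / l ^ M := by
    refine Summable.tsum_le_tsum (fun m => ?_)
      ((summable_nat_add_iff M).2 (hsum x).summable)
      (((summable_nat_add_iff M).2 (hsum (l * x)).summable).div_const _)
    rw [le_div_iff₀ (by positivity), mul_pow, pow_add l, div_mul_eq_mul_div]
    gcongr ?_ / _
    nlinarith [mul_nonneg (mul_nonneg (pow_nonneg hx (m + M)) (pow_pos hl0 M).le)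
      (sub_nonneg.2 (one_le_pow₀ hl : 1 ≤ l ^ m))]
  rw [tsum_div_const] at hle
  have h1 := (hsum x).summable.sum_add_tsum_nat_add M
  have h2 := (hsum (l * x)).summable.sum_add_tsum_nat_add M
  rw [(hsum x).tsum_eq] at h1
  rw [(hsum (l * x)).tsum_eq] at h2
  have h3 : 0 ≤ ∑ m ∈ Finset.range M, (l * x) ^ m / m.factorial :=
    Finset.sum_nonneg fun m _ => by positivity
  calc _ = ∑' m : ℕ, x ^ (m + M) / (m + M).factorial := by linarith
    _ ≤ _ := hle
    _ ≤ _ := by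
      gcongr
      linarith

/-- The Taylor polynomial of degree `< M` of `exp`. -/
noncomputable def expPoly (M : ℕ) (w : ℂ) : ℂ := ∑ m ∈ Finset.range M, w ^ m / m.factorial

lemma continuous_expPoly (M : ℕ) : Continuous (expPoly M) := by
  unfold expPoly
  fun_prop

lemma norm_exp_mul_exp_sub_le (x ε : ℝ) (hx : 0 ≤ x) (z w : ℂ) (hz : ‖z‖ = 1) (hw : ‖w‖ = 1)
    (N M : ℕ) (hN : Real.exp x - ∑ m ∈ Finset.range N, x ^ m / m.factorial ≤ ε)
    (hM : Real.exp x - ∑ m ∈ Finset.range M, x ^ m / m.factorial ≤ ε) :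
    ‖Complex.exp (x * z) * Complex.exp (x * w) - expPoly N (x * z) * expPoly M (x * w)‖
      ≤ 2 * Real.exp x * ε := by
  have hxz : ‖(x : ℂ) * z‖ = x := by
    rw [norm_mul, hz, Complex.norm_real, Real.norm_of_nonneg hx, mul_one]
  have hxw : ‖(x : ℂ) * w‖ = x := by
    rw [norm_mul, hw, Complex.norm_real, Real.norm_of_nonneg hx, mul_one]
  have h1 := Complex.norm_exp_sub_sum_le_exp_norm_sub_sum (x * z) N
  have h2 := Complex.norm_exp_sub_sum_le_exp_norm_sub_sum (x * w) M
  rw [hxz] at h1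
  rw [hxw] at h2
  have h3 : ‖Complex.exp (x * w)‖ ≤ Real.exp x := by
    simpa only [hxw] using Complex.norm_exp_le_exp_norm (x * w)
  have h4 : ‖expPoly N (x * z)‖ ≤ Real.exp x := by
    refine (norm_sum_le _ _).trans ?_
    simp only [norm_div, norm_pow, hxz, Complex.norm_natCast]
    exact Real.sum_le_exp_of_nonneg hx N
  have hε : 0 ≤ ε := (norm_nonneg _).trans (h1.trans hN)
  calc _ = ‖(Complex.exp (x * z) - expPoly N (x * z)) * Complex.exp (x * w) +
        expPoly N (x * z) * (Complex.exp (x * w) - expPoly M (x * w))‖ := by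
          congr 1
          ring
    _ ≤ ε * Real.exp x + Real.exp x * ε := by
      refine (norm_add_le _ _).trans ?_
      rw [norm_mul, norm_mul]
      gcongr
      · exact h1.trans hN
      · exact h2.trans hM
    _ = _ := by ring

lemma integral_expPoly_mul_expPoly (x : ℝ) (N : ℕ) :
    ∫ t in (0:ℝ)..(2 * Real.pi), expPoly N (x * Complex.exp ((t : ℂ) * Complex.I)) *
        expPoly N (x * Complex.exp (-(t : ℂ) * Complex.I)) =
      ((2 * Real.pi * ∑ m ∈ Finset.range N, (x ^ m / m.factorial) ^ 2 : ℝ) : ℂ) := by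
  have h := integral_trigPoly_mul_conj_trigPoly (fun m => (x : ℂ) ^ m / m.factorial)
    (fun m => (x : ℂ) ^ m / m.factorial) N N le_rfl
  simp only [expPoly, mul_pow, mul_div_right_comm]
  rw [h]
  push_cast
  simp only [sq]

lemma integral_expPoly_mul_shifted_expPoly (x : ℝ) (N : ℕ) (hN : 1 ≤ N) :
    ∫ t in (0:ℝ)..(2 * Real.pi), expPoly N (x * Complex.exp ((t : ℂ) * Complex.I)) *
        (expPoly (N - 1) (x * Complex.exp (-(t : ℂ) * Complex.I)) *
          Complex.exp (-(t : ℂ) * Complex.I)) =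
      ((2 * Real.pi * ∑ m ∈ Finset.range (N - 1),
        (x ^ (m + 1) / (m + 1).factorial) * (x ^ m / m.factorial) : ℝ) : ℂ) := by
  obtain ⟨n, rfl⟩ := Nat.exists_eq_add_of_le' hN
  have h := integral_trigPoly_mul_conj_trigPoly (fun m => (x : ℂ) ^ m / m.factorial)
    (fun m => if m = 0 then 0 else (x : ℂ) ^ (m - 1) / (m - 1).factorial) (n + 1) (n + 1) le_rfl
  simp only [Finset.sum_range_succ' _ n, Nat.succ_ne_zero, if_false, if_true,
    add_tsub_cancel_right, zero_mul, mul_zero, add_zero] at h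
  simp only [add_tsub_cancel_right]
  push_cast
  rw [← h]
  refine intervalIntegral.integral_congr fun t _ => ?_
  simp only [expPoly, Finset.sum_range_succ' _ n, mul_pow, mul_div_right_comm, Finset.sum_mul,
    pow_succ (Complex.exp (-(t : ℂ) * Complex.I)), mul_assoc, pow_zero]

lemma norm_exp_neg_mul_I (t : ℝ) : ‖Complex.exp (-(t : ℂ) * Complex.I)‖ = 1 := by
  rw [← Complex.ofReal_neg, Complex.norm_exp_ofReal_mul_I]

lemma norm_besselSum_sub_le (s : ℝ) (hs₀ : 0 < s) (hs₁ : s < 1) (N : ℕ) (hN : 1 ≤ N) :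
    ‖((2 * Real.pi * besselSum s N : ℝ) : ℂ) - ∫ t in (0:ℝ)..(2 * Real.pi),
      (Real.exp (2 * s * N * Real.cos t) : ℂ) * (1 - s * Complex.exp (-(t : ℂ) * Complex.I))‖
      ≤ 8 * Real.pi / s * (Real.exp ((1 + s) * N) * s ^ N) := by
  set x : ℝ := s * N with hx
  have hx0 : 0 ≤ x := by positivity
  have hP : ∀ M, Continuous (expPoly M) := continuous_expPoly
  have heq : ((2 * Real.pi * besselSum s N : ℝ) : ℂ) = ∫ t in (0:ℝ)..(2 * Real.pi),
      (expPoly N (x * Complex.exp ((t : ℂ) * Complex.I)) *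
        expPoly N (x * Complex.exp (-(t : ℂ) * Complex.I)) -
        s * (expPoly N (x * Complex.exp ((t : ℂ) * Complex.I)) *
        (expPoly (N - 1) (x * Complex.exp (-(t : ℂ) * Complex.I)) *
          Complex.exp (-(t : ℂ) * Complex.I)))) := by
    rw [intervalIntegral.integral_sub (Continuous.intervalIntegrable (by fun_prop) _ _)
      (Continuous.intervalIntegrable (by fun_prop) _ _), intervalIntegral.integral_const_mul,
      integral_expPoly_mul_expPoly, integral_expPoly_mul_shifted_expPoly x N hN, besselSum, ← hx]
    push_cast
    ring
  have hε : ∀ M, N - 1 ≤ M → Real.exp x - ∑ m ∈ Finset.range M, x ^ m / m.factorial ≤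
      Real.exp N * s ^ (N - 1) := fun M hM => by
    refine (exp_sub_sum_le x (1 / s) hx0 ((one_le_div hs₀).2 hs₁.le) M).trans ?_
    rw [show 1 / s * x = N by rw [hx]; field_simp, one_div_pow, div_div_eq_mul_div, div_one]
    gcongr ?_ * ?_
    exact pow_le_pow_of_le_one hs₀.le hs₁.le hM
  have hexp (t : ℝ) : (Real.exp (2 * s * N * Real.cos t) : ℂ) =
      Complex.exp (x * Complex.exp ((t : ℂ) * Complex.I)) *
        Complex.exp (x * Complex.exp (-(t : ℂ) * Complex.I)) := by
    rw [← Complex.exp_add, ← mul_add]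
    push_cast
    rw [Complex.cos, hx]
    push_cast
    ring_nf
  rw [heq, ← intervalIntegral.integral_sub (Continuous.intervalIntegrable (by fun_prop) _ _)
      (Continuous.intervalIntegrable (by fun_prop) _ _)]
  have hbound : ∀ t ∈ Set.uIoc (0:ℝ) (2 * Real.pi),
      ‖(expPoly N (x * Complex.exp ((t : ℂ) * Complex.I)) *
        expPoly N (x * Complex.exp (-(t : ℂ) * Complex.I)) -
        s * (expPoly N (x * Complex.exp ((t : ℂ) * Complex.I)) *
        (expPoly (N - 1) (x * Complex.exp (-(t : ℂ) * Complex.I)) *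
          Complex.exp (-(t : ℂ) * Complex.I)))) -
      (Real.exp (2 * s * N * Real.cos t) : ℂ) * (1 - s * Complex.exp (-(t : ℂ) * Complex.I))‖ ≤
        4 * Real.exp x * (Real.exp N * s ^ (N - 1)) := fun t _ => by
    have hz : ‖Complex.exp ((t : ℂ) * Complex.I)‖ = 1 := Complex.norm_exp_ofReal_mul_I t
    have hw := norm_exp_neg_mul_I t
    rw [hexp t]
    generalize Complex.exp ((t : ℂ) * Complex.I) = z at *
    generalize Complex.exp (-(t : ℂ) * Complex.I) = w at *
    have h1 := norm_exp_mul_exp_sub_le x _ hx0 z w hz hw N N (hε N (by omega)) (hε N (by omega))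
    have h2 := norm_exp_mul_exp_sub_le x _ hx0 z w hz hw N (N - 1) (hε N (by omega)) (hε _ le_rfl)
    calc _ = ‖s * w * (Complex.exp (x * z) * Complex.exp (x * w) -
            expPoly N (x * z) * expPoly (N - 1) (x * w)) -
          (Complex.exp (x * z) * Complex.exp (x * w) - expPoly N (x * z) * expPoly N (x * w))‖ := by
            congr 1
            ring
      _ ≤ 1 * (2 * Real.exp x * (Real.exp N * s ^ (N - 1))) +
          2 * Real.exp x * (Real.exp N * s ^ (N - 1)) := by
        refine (norm_sub_le _ _).trans (add_le_add ?_ h1)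
        rw [norm_mul]
        refine mul_le_mul ?_ h2 (norm_nonneg _) zero_le_one
        rw [norm_mul, hw, Complex.norm_real, Real.norm_of_nonneg hs₀.le]
        linarith
      _ = _ := by ring
  refine (intervalIntegral.norm_integral_le_of_norm_le_const hbound).trans (le_of_eq ?_)
  rw [sub_zero, abs_of_pos (by positivity), add_mul, Real.exp_add, one_mul, ← hx]
  obtain ⟨n, rfl⟩ := Nat.exists_eq_add_of_le' hN
  rw [add_tsub_cancel_right, pow_succ]
  field_simp
  ring

lemma tendsto_mul_one_sub_cos (u : ℝ) :
    Tendsto (fun N : ℕ => (N : ℝ) * (1 - Real.cos (u / Real.sqrt N))) atTop (nhds (u ^ 2 / 2)) := by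
  have hy : Tendsto (fun N : ℕ => u / Real.sqrt N / 2) atTop (nhds 0) := by
    have h : Tendsto (fun N : ℕ => u / Real.sqrt N) atTop (nhds 0) :=
      Tendsto.const_div_atTop (Real.tendsto_sqrt_atTop.comp tendsto_natCast_atTop_atTop) u
    simpa using h.div_const 2
  have hc := ((Real.continuous_sinc.tendsto 0).comp hy).pow 2
  rw [Real.sinc_zero] at hc
  have := hc.const_mul (u ^ 2 / 2)
  rw [one_pow, mul_one] at this
  refine this.congr' ?_
  filter_upwards [eventually_gt_atTop 0] with N hN
  have hN' : (0:ℝ) < N := by exact_mod_cast hN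
  have hsq := Real.sq_sqrt hN'.le
  have hpos := Real.sqrt_pos.2 hN'
  rcases eq_or_ne u 0 with rfl | hu
  · simp
  have hcos : Real.cos (u / Real.sqrt N) = 1 - 2 * Real.sin (u / Real.sqrt N / 2) ^ 2 := by
    have := Real.cos_two_mul (u / Real.sqrt N / 2)
    rw [mul_div_cancel₀ _ two_ne_zero] at this
    rw [this, Real.cos_sq']
    ring
  rw [Function.comp_apply, Real.sinc_of_ne_zero (by positivity), hcos]
  generalize Real.sin (u / Real.sqrt N / 2) = y
  field_simp
  rw [hsq]
  ring

lemma tendsto_laplace_cos (a : ℝ) (ha : 0 < a) (f : ℝ → ℂ) (hf : Continuous f)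
    (hper : Function.Periodic f (2 * Real.pi)) (C : ℝ) (hC : ∀ t, ‖f t‖ ≤ C) :
    Tendsto (fun N : ℕ => (Real.sqrt N : ℂ) * ∫ t in (0:ℝ)..(2 * Real.pi),
      (Real.exp (-a * (N * (1 - Real.cos t))) : ℂ) * f t) atTop
      (nhds ((Real.sqrt (2 * Real.pi / a) : ℂ) * f 0)) := by
  have hπ := Real.pi_pos
  let F : ℕ → ℝ → ℂ := fun N => (Set.Ioc (-Real.pi * Real.sqrt N) (Real.pi * Real.sqrt N)).indicator
    fun u => (Real.exp (-a * (N * (1 - Real.cos (u / Real.sqrt N)))) : ℂ) * f (u / Real.sqrt N)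
  have hlim : Tendsto (fun N => ∫ u, F N u) atTop
      (nhds (∫ u : ℝ, (Real.exp (-(a / 2) * u ^ 2) : ℂ) * f 0)) := by
    refine tendsto_integral_of_dominated_convergence
      (fun u => Real.exp (-(2 * a / Real.pi ^ 2) * u ^ 2) * C) (fun N => ?_)
      ((integrable_exp_neg_mul_sq (by positivity)).mul_const C) (fun N => ?_) ?_
    · exact (Continuous.aestronglyMeasurable (by fun_prop)).indicator measurableSet_Ioc
    · refine Eventually.of_forall fun u => ?_
      have hC0 : 0 ≤ C := (norm_nonneg _).trans (hC 0)
      by_cases hu : u ∈ Set.Ioc (-Real.pi * Real.sqrt N) (Real.pi * Real.sqrt N)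
      · simp only [F, Set.indicator_of_mem hu]
        rw [norm_mul, Complex.norm_real, Real.norm_of_nonneg (Real.exp_nonneg _)]
        refine mul_le_mul (Real.exp_le_exp.2 ?_) (hC _) (norm_nonneg _) (Real.exp_nonneg _)
        have hs : 0 < Real.sqrt N := by
          by_contra h
          have h0 : Real.sqrt N = 0 := le_antisymm (not_lt.1 h) (Real.sqrt_nonneg _)
          rw [h0] at hu
          simp at hu
        have hN : (0:ℝ) < N := Real.sqrt_pos.1 hs
        have hcos := Real.cos_le_one_sub_mul_cos_sq (x := u / Real.sqrt N) (by
          rw [abs_div, abs_of_pos hs, div_le_iff₀ hs, abs_le]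
          exact ⟨by linarith [hu.1], hu.2⟩)
        rw [div_pow, Real.sq_sqrt hN.le] at hcos
        have h2 : 2 / Real.pi ^ 2 * u ^ 2 ≤ N * (1 - Real.cos (u / Real.sqrt N)) := by
          calc 2 / Real.pi ^ 2 * u ^ 2 = N * (2 / Real.pi ^ 2 * (u ^ 2 / N)) := by field_simp
            _ ≤ _ := by
              gcongr
              linarith
        calc _ ≤ -a * (2 / Real.pi ^ 2 * u ^ 2) := by nlinarith
          _ = _ := by ring
      · simp only [F, Set.indicator_of_notMem hu, norm_zero]
        positivity
    · refine Eventually.of_forall fun u => ?_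
      have hsqrt : Tendsto (fun N : ℕ => Real.sqrt N) atTop atTop :=
        Real.tendsto_sqrt_atTop.comp tendsto_natCast_atTop_atTop
      have h0 : Tendsto (fun N : ℕ => u / Real.sqrt N) atTop (nhds 0) := hsqrt.const_div_atTop u
      have h1 := ((Complex.continuous_ofReal.comp Real.continuous_exp).tendsto _).comp
        ((tendsto_mul_one_sub_cos u).const_mul (-a))
      have h2 := h1.mul ((hf.tendsto 0).comp h0)
      rw [show -a * (u ^ 2 / 2) = -(a / 2) * u ^ 2 by ring] at h2
      refine h2.congr' ?_
      filter_upwards [hsqrt.eventually_gt_atTop (|u| / Real.pi)] with N hN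
      rw [div_lt_iff₀ hπ] at hN
      have hu := abs_lt.1 hN
      simp only [F]
      rw [Set.indicator_of_mem (Set.mem_Ioc.2 ⟨by linarith [hu.1], by linarith [hu.2]⟩)]
      rfl
  rw [integral_mul_const, integral_complex_ofReal, integral_gaussian,
    show Real.pi / (a / 2) = 2 * Real.pi / a by field_simp] at hlim
  refine hlim.congr' ?_
  filter_upwards [eventually_gt_atTop 0] with N hN
  have hs : 0 < Real.sqrt N := Real.sqrt_pos.2 (by exact_mod_cast hN)
  let g : ℝ → ℂ := fun t => (Real.exp (-a * (N * (1 - Real.cos t))) : ℂ) * f t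
  have hg : Function.Periodic g (2 * Real.pi) := fun t => by
    simp only [g, Real.cos_add_two_pi, hper t]
  have hshift := hg.intervalIntegral_add_eq 0 (-Real.pi)
  rw [zero_add, show -Real.pi + 2 * Real.pi = Real.pi by ring] at hshift
  change _ = (Real.sqrt N : ℂ) * ∫ t in (0:ℝ)..(2 * Real.pi), g t
  rw [hshift]
  simp only [F]
  rw [integral_indicator measurableSet_Ioc, ← intervalIntegral.integral_of_le (by nlinarith)]
  have := intervalIntegral.integral_comp_div (a := -Real.pi * Real.sqrt N)
    (b := Real.pi * Real.sqrt N) g hs.ne'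
  rw [mul_div_cancel_right₀ _ hs.ne', mul_div_cancel_right₀ _ hs.ne', Complex.real_smul] at this
  exact this

lemma tendsto_besselSum (s : ℝ) (hs₀ : 0 < s) (hs₁ : s < 1) :
    Tendsto (fun N : ℕ => Real.sqrt N * Real.exp (-(2 * s * N)) * (2 * Real.pi * besselSum s N))
      atTop (nhds (Real.sqrt (Real.pi / s) * (1 - s))) := by
  have hlap := tendsto_laplace_cos (2 * s) (by positivity)
    (fun t : ℝ => 1 - s * Complex.exp (-(t : ℂ) * Complex.I)) (by fun_prop)
    (fun t => by
      have := Complex.exp_periodic.sub_eq (-(t : ℂ) * Complex.I)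
      simp only
      rw [← this]
      push_cast
      ring_nf) (1 + s) (fun t => by
        refine (norm_sub_le _ _).trans ?_
        rw [norm_mul, norm_exp_neg_mul_I, Complex.norm_real, Real.norm_of_nonneg hs₀.le]
        simp)
  have hr1 : s * Real.exp (1 - s) < 1 := by
    have h := Real.add_one_lt_exp (x := s - 1) (by linarith)
    calc s * Real.exp (1 - s) < Real.exp (s - 1) * Real.exp (1 - s) := by
          gcongr
          linarith
      _ = 1 := by
        rw [← Real.exp_add]
        simp
  have herr : Tendsto (fun N : ℕ => 8 * Real.pi / s * ((N : ℝ) ^ 1 * (s * Real.exp (1 - s)) ^ N))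
      atTop (nhds 0) := by
    have := (tendsto_pow_const_mul_const_pow_of_abs_lt_one 1
      (r := s * Real.exp (1 - s)) (by rwa [abs_of_pos (by positivity)])).const_mul
        (8 * Real.pi / s)
    rwa [mul_zero] at this
  have hdiff : Tendsto (fun N : ℕ =>
      ((Real.sqrt N * Real.exp (-(2 * s * N)) * (2 * Real.pi * besselSum s N) : ℝ) : ℂ) -
      (Real.sqrt N : ℂ) * ∫ t in (0:ℝ)..(2 * Real.pi),
      (Real.exp (-(2 * s) * (N * (1 - Real.cos t))) : ℂ) *
        (1 - s * Complex.exp (-(t : ℂ) * Complex.I))) atTop (nhds 0) := by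
    refine squeeze_zero_norm' ?_ herr
    filter_upwards [eventually_ge_atTop 1] with N hN
    have hint : (∫ t in (0:ℝ)..(2 * Real.pi), (Real.exp (-(2 * s) * (N * (1 - Real.cos t))) : ℂ) *
        (1 - s * Complex.exp (-(t : ℂ) * Complex.I))) = (Real.exp (-(2 * s * N)) : ℂ) *
        ∫ t in (0:ℝ)..(2 * Real.pi), (Real.exp (2 * s * N * Real.cos t) : ℂ) *
          (1 - s * Complex.exp (-(t : ℂ) * Complex.I)) := by
      rw [← intervalIntegral.integral_const_mul]
      refine intervalIntegral.integral_congr fun t _ => ?_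
      rw [show -(2 * s) * (N * (1 - Real.cos t)) = -(2 * s * N) + 2 * s * N * Real.cos t by ring,
        Real.exp_add, Complex.ofReal_mul, mul_assoc]
    have hN1 : (1:ℝ) ≤ N := by exact_mod_cast hN
    rw [hint, Complex.ofReal_mul (_ * _), Complex.ofReal_mul (Real.sqrt N), ← mul_assoc, ← mul_sub,
      norm_mul, ← Complex.ofReal_mul, Complex.norm_real, Real.norm_of_nonneg (by positivity)]
    calc _ ≤ N * Real.exp (-(2 * s * N)) *
          (8 * Real.pi / s * (Real.exp ((1 + s) * N) * s ^ N)) := by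
            gcongr
            · rw [Real.sqrt_le_left (by positivity)]
              nlinarith
            · exact norm_besselSum_sub_le s hs₀ hs₁ N hN
      _ = 8 * Real.pi / s * (N * ((Real.exp (-(2 * s * N)) * Real.exp ((1 + s) * N)) * s ^ N)) := by
        ring
      _ = _ := by
        rw [← Real.exp_add, mul_pow, ← Real.exp_nat_mul]
        ring_nf
  have h := hdiff.add hlap
  simp only [sub_add_cancel, zero_add] at h
  rw [show 2 * Real.pi / (2 * s) = Real.pi / s by field_simp,
    show (Real.sqrt (Real.pi / s) : ℂ) * (1 - s * Complex.exp (-((0:ℝ) : ℂ) * Complex.I)) =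
      ((Real.sqrt (Real.pi / s) * (1 - s) : ℝ) : ℂ) by simp] at h
  have h' := (Complex.continuous_re.tendsto _).comp h
  simpa only [Function.comp_def, Complex.ofReal_re] using h'

lemma factorial_pred_div_pow_sq (N : ℕ) (hN : 1 ≤ N) :
    (((N - 1).factorial : ℝ) / N ^ N) ^ 2 =
      Stirling.stirlingSeq N ^ 2 * (2 / N) * Real.exp (-(2 * N)) := by
  have hN0 : (0:ℝ) < N := by exact_mod_cast hN
  have h2 : Real.sqrt (2 * N) ^ 2 = 2 * N := Real.sq_sqrt (by positivity)
  have he : Real.exp 1 ^ N = Real.exp N := by rw [← Real.exp_nat_mul, mul_one]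
  have he' : Real.exp (-(2 * N)) = (Real.exp N ^ 2)⁻¹ := by
    rw [Real.exp_neg, ← Real.exp_nat_mul]
    norm_num
  rw [Stirling.stirlingSeq, ← Nat.mul_factorial_pred (by omega : N ≠ 0), div_pow (N : ℝ), he, he']
  push_cast
  simp only [div_pow, mul_pow, h2]
  have := Real.exp_pos N
  field_simp

lemma Itilde_one_tendsto (s : ℝ) (hs₀ : 0 < s) (hs₁ : s < 1) :
    Tendsto (fun N : ℕ => Itilde s N 1) atTop
      (nhds (((Real.sqrt s * (1 - s) / 2 : ℝ)) : ℂ)) := by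
  have hπ := Real.pi_pos
  have hratio : Tendsto (fun N : ℕ => (N : ℝ) / (N - 1)) atTop (nhds 1) := by
    have h := (tendsto_natCast_div_add_atTop (𝕜 := ℝ) (-1 : ℝ))
    simpa only [← sub_eq_add_neg] using h
  have hmain := ((hratio.mul (Stirling.tendsto_stirlingSeq_sqrt_pi.pow 2)).mul
    (tendsto_besselSum s hs₀ hs₁)).const_mul
      (2 * s / (Real.sqrt 2 * (2 * Real.pi) ^ ((3:ℝ) / 2)))
  have hpow (y : ℝ) (hy : 0 < y) : y ^ ((3:ℝ) / 2) = y * Real.sqrt y := by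
    rw [show (3:ℝ) / 2 = 1 + 1 / 2 by norm_num, Real.rpow_add hy, Real.rpow_one, Real.sqrt_eq_rpow]
  have hval : 2 * s / (Real.sqrt 2 * (2 * Real.pi) ^ ((3:ℝ) / 2)) *
      (1 * Real.sqrt Real.pi ^ 2 * (Real.sqrt (Real.pi / s) * (1 - s))) =
        Real.sqrt s * (1 - s) / 2 := by
    rw [hpow _ (by positivity), Real.sqrt_mul (by norm_num), Real.sqrt_div hπ.le]
    have h2 := Real.sq_sqrt (zero_le_two : (0:ℝ) ≤ 2)
    have h3 := Real.sq_sqrt hs₀.le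
    have h4 := Real.sq_sqrt hπ.le
    have h5 := Real.sqrt_pos.2 hs₀
    have h6 := Real.sqrt_pos.2 hπ
    rw [h4]
    field_simp
    rw [h2, h3]
  rw [hval] at hmain
  refine ((Complex.continuous_ofReal.tendsto _).comp hmain).congr' ?_
  filter_upwards [eventually_ge_atTop 3] with N hN
  have hN0 : (0:ℝ) < N := by
    have : 0 < N := by omega
    exact_mod_cast this
  rw [Itilde_one_eq s N hN, Function.comp_apply, factorial_pred_div_pow_sq N (by omega),
    Real.div_rpow hN0.le (by positivity), hpow _ hN0,
    show Real.exp (2 * N * (1 - s)) = Real.exp (-(2 * s * N)) * Real.exp (2 * N) by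
      rw [← Real.exp_add]
      ring_nf, Real.exp_neg (2 * N)]
  congr 1
  have := Real.exp_pos (2 * N)
  have h2 : (0:ℝ) < (2 * Real.pi) ^ ((3:ℝ) / 2) := by positivity
  generalize (N : ℝ) / (N - 1) = α
  field_simp

lemma Itilde_two_eq_conj (s : ℝ) (N : ℕ) : Itilde s N 2 = (starRingEnd ℂ) (Itilde s N 1) := by
  rw [Itilde, Itilde, map_mul, ← integral_conj, Complex.conj_ofReal]
  simp only [map_mul, Complex.conj_ofReal]
  rfl

/-- For `0 < s < 1`, `Ĩ_{1,N}(s)` and `Ĩ_{2,N}(s)` both converge to `√s (1 − s)/2`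
as `N → ∞`. -/
theorem Itilde12_tendsto (s : ℝ) (hs₀ : 0 < s) (hs₁ : s < 1) :
    Tendsto (fun N : ℕ => Itilde s N 1) atTop
        (nhds (((Real.sqrt s * (1 - s) / 2 : ℝ)) : ℂ)) ∧
      Tendsto (fun N : ℕ => Itilde s N 2) atTop
        (nhds (((Real.sqrt s * (1 - s) / 2 : ℝ)) : ℂ)) := by
  have h := Itilde_one_tendsto s hs₀ hs₁
  refine ⟨h, ?_⟩
  have h' := (Complex.continuous_conj.tendsto _).comp h
  rw [Complex.conj_ofReal] at h'
  exact h'.congr fun N => (Itilde_two_eq_conj s N).symm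
end
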